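/- arXiv:2507.19617 — 3 statements merged into one kernel-verified Lean document; each statement's English description precedes it below -/
import Mathlib

section
/- Let K be a field, B ≥ 2 and d ≥ 1 integers, let I ⊆ K[x_1,…,x_{B+1}] be an ideal generated by a homogeneous regular sequence of c ≥ 1 forms each of degree at most d, and let f be a nonzero form of degree at most cd − c. Then the minimal number of generators of the colon ideal I:(f) satisfies β₀(I:(f)) ≤ B(d+1)(2d)·∏_{i=3}^{B}((d²+2d−1)^{2^{i−3}} + 1) + 1 (the product being empty if B < 3). If moreover B ≥ 4, or B = 3 and d ≥ 3, then in addition β₀(I:(f)) ≤ (2d)^{2^{B−1}}. -/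
open MvPolynomial

namespace ColonBound

section Regular

variable {R : Type*} [CommRing R]

/-- `y` is a nonzerodivisor modulo the ideal `𝔞`. -/
def RegMod (y : R) (𝔞 : Ideal R) : Prop := ∀ u, y * u ∈ 𝔞 → u ∈ 𝔞

/-- The quotient by `𝔞` contains no nonzero element killed by `𝔪`. -/
def SocleFree (𝔪 𝔞 : Ideal R) : Prop := ∀ u, (∀ w ∈ 𝔪, w * u ∈ 𝔞) → u ∈ 𝔞

/-- There is a sequence of `n` elements of `𝔪` which is regular modulo `𝔞`. -/
def DepthGE (𝔪 : Ideal R) : ℕ → Ideal R → Prop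
  | 0, _ => True
  | n + 1, 𝔞 => ∃ z ∈ 𝔪, RegMod z 𝔞 ∧ DepthGE 𝔪 n (𝔞 ⊔ Ideal.span {z})

/-- Up to elements of a power of `𝔪`, `y` is a nonzerodivisor modulo `𝔠`. -/
def FilterReg (𝔪 : Ideal R) (y : R) (𝔠 : Ideal R) : Prop :=
  ∃ n : ℕ, ∀ u, y * u ∈ 𝔠 → u ∈ 𝔪 ^ n → u ∈ 𝔠

theorem mem_sup_span {𝔞 : Ideal R} {z u : R} :
    u ∈ 𝔞 ⊔ Ideal.span {z} ↔ ∃ a ∈ 𝔞, ∃ b, u = a + z * b := by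
  rw [Submodule.mem_sup]
  constructor
  · rintro ⟨a, ha, w, hw, rfl⟩
    obtain ⟨b, rfl⟩ := Ideal.mem_span_singleton'.1 hw
    exact ⟨a, ha, b, by ring⟩
  · rintro ⟨a, ha, b, rfl⟩
    exact ⟨a, ha, z * b, Ideal.mul_mem_right _ _ (Ideal.mem_span_singleton_self z), rfl⟩

theorem RegMod.socleFree {𝔪 𝔞 : Ideal R} {y : R} (hy : y ∈ 𝔪) (h : RegMod y 𝔞) :
    SocleFree 𝔪 𝔞 := fun u hu => h u (hu y hy)

theorem SocleFree.regMod {𝔪 𝔞 : Ideal R} {y : R} (h : SocleFree 𝔪 𝔞)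
    (hy : FilterReg 𝔪 y 𝔞) : RegMod y 𝔞 := by
  obtain ⟨n, hn⟩ := hy
  have key : ∀ k : ℕ, ∀ u, (∀ w ∈ 𝔪 ^ k, w * u ∈ 𝔞) → u ∈ 𝔞 := by
    intro k
    induction k with
    | zero => intro u hu; simpa using hu 1 (by simp)
    | succ k ih =>
      intro u hu
      refine ih u fun w hw => h _ fun v hv => ?_
      have := hu (w * v) (by rw [pow_succ]; exact Ideal.mul_mem_mul hw hv)
      rwa [show v * (w * u) = w * v * u by ring]
  intro u hu
  refine key n u fun w hw => hn _ ?_ (Ideal.mul_mem_right _ _ hw)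
  rw [show y * (w * u) = w * (y * u) by ring]
  exact Ideal.mul_mem_left _ _ hu

/-- Socle elements modulo `𝔞 + (z)` can be moved to socle elements modulo `𝔞 + (x)`. -/
theorem SocleFree.exchange {𝔪 𝔞 : Ideal R} {x z : R} (hz : z ∈ 𝔪)
    (hxr : RegMod x 𝔞) (hzr : RegMod z 𝔞) (h : SocleFree 𝔪 (𝔞 ⊔ Ideal.span {z})) :
    SocleFree 𝔪 (𝔞 ⊔ Ideal.span {x}) := by
  intro u hu
  obtain ⟨a, ha, v, hv⟩ := mem_sup_span.1 (hu z hz)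
  have hv' : v ∈ 𝔞 ⊔ Ideal.span {z} := by
    refine h v fun w hw => ?_
    obtain ⟨b, hb, u', hu'⟩ := mem_sup_span.1 (hu w hw)
    have : w * v - z * u' ∈ 𝔞 := by
      apply hxr
      have : x * (w * v - z * u') = z * b - w * a := by
        linear_combination (-w) * hv + z * hu'
      rw [this]
      exact 𝔞.sub_mem (𝔞.mul_mem_left _ hb) (𝔞.mul_mem_left _ ha)
    exact mem_sup_span.2 ⟨_, this, u', by ring⟩
  obtain ⟨b, hb, v', rfl⟩ := mem_sup_span.1 hv'
  have : u - x * v' ∈ 𝔞 := by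
    apply hzr
    have : z * (u - x * v') = a + x * b := by linear_combination hv
    rw [this]
    exact 𝔞.add_mem ha (𝔞.mul_mem_left _ hb)
  exact mem_sup_span.2 ⟨_, this, v', by ring⟩

theorem RegMod.swap {𝔞 : Ideal R} {g y : R} (hg : RegMod g 𝔞)
    (hy : RegMod y (𝔞 ⊔ Ideal.span {g})) : RegMod g (𝔞 ⊔ Ideal.span {y}) := by
  intro u hu
  obtain ⟨a, ha, m, hm⟩ := mem_sup_span.1 hu
  have : m ∈ 𝔞 ⊔ Ideal.span {g} :=
    hy m (mem_sup_span.2 ⟨-a, 𝔞.neg_mem ha, u, by linear_combination -hm⟩)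
  obtain ⟨b, hb, n, rfl⟩ := mem_sup_span.1 this
  have : u - y * n ∈ 𝔞 := by
    apply hg
    have : g * (u - y * n) = a + y * b := by linear_combination hm
    rw [this]
    exact 𝔞.add_mem ha (𝔞.mul_mem_left _ hb)
  exact mem_sup_span.2 ⟨_, this, n, by ring⟩

theorem DepthGE.socleFree {𝔪 𝔞 : Ideal R} {n : ℕ} (h : DepthGE 𝔪 (n + 1) 𝔞) :
    SocleFree 𝔪 𝔞 := by
  obtain ⟨z, hz, hr, -⟩ := h
  exact hr.socleFree hz

/-- Depth drops by one modulo a nonzerodivisor, provided filter-regular elements exist. -/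
theorem DepthGE.sup_span {𝔪 : Ideal R}
    (hA : ∀ s : Finset (Ideal R), ∃ y ∈ 𝔪, ∀ 𝔠 ∈ s, FilterReg 𝔪 y 𝔠) :
    ∀ (n : ℕ) (𝔞 : Ideal R) (f : R), DepthGE 𝔪 (n + 1) 𝔞 → f ∈ 𝔪 → RegMod f 𝔞 →
      DepthGE 𝔪 n (𝔞 ⊔ Ideal.span {f}) := by
  classical
  intro n
  induction n with
  | zero => intro _ _ _ _ _; trivial
  | succ n ih =>
    intro 𝔞 f hd hf hfr
    obtain ⟨g, hg, hgr, hgd⟩ := hd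
    have hf_free : SocleFree 𝔪 (𝔞 ⊔ Ideal.span {f}) := hgd.socleFree.exchange hg hfr hgr
    obtain ⟨y, hy, hys⟩ := hA {𝔞, 𝔞 ⊔ Ideal.span {g}, 𝔞 ⊔ Ideal.span {f}}
    have hy1 : RegMod y 𝔞 := (hgr.socleFree hg).regMod (hys _ (by simp))
    have hy2 : RegMod y (𝔞 ⊔ Ideal.span {g}) := hgd.socleFree.regMod (hys _ (by simp))
    have hy3 : RegMod y (𝔞 ⊔ Ideal.span {f}) := hf_free.regMod (hys _ (by simp))
    have h1 := ih _ y hgd hy hy2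
    rw [sup_right_comm] at h1
    have h2 : DepthGE 𝔪 (n + 1) (𝔞 ⊔ Ideal.span {y}) := ⟨g, hg, hgr.swap hy2, h1⟩
    have h3 := ih _ f h2 hf (hfr.swap hy3)
    rw [sup_right_comm] at h3
    exact ⟨y, hy, hy3, h3⟩

end Regular

section LinearForms

variable {K σ : Type*} [Field K] [Fintype σ]

/-- Over an infinite field there is a linear form that is simultaneously filter-regular modulo
finitely many ideals. -/
theorem exists_linear_filterReg [Infinite K] (s : Finset (Ideal (MvPolynomial σ K))) :
    ∃ a : σ → K, ∀ 𝔠 ∈ s, FilterReg (idealOfVars σ K) (∑ i, a i • X i) 𝔠 := by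
  classical
  choose t ht using fun 𝔠 : Ideal (MvPolynomial σ K) =>
    Submodule.isLasker (MvPolynomial σ K) (MvPolynomial σ K) 𝔠
  let lin : (σ → K) →ₗ[K] MvPolynomial σ K :=
    Fintype.linearCombination K (X : σ → MvPolynomial σ K)
  let sub : Ideal (MvPolynomial σ K) → Submodule K (σ → K) := fun (Q : Ideal (MvPolynomial σ K)) =>
    Submodule.comap lin (Submodule.restrictScalars K (Ideal.radical Q))
  let bad := ((s.biUnion t).image sub).filter (· ≠ ⊤)
  have hbad : ⊤ ∉ bad := by simp [bad]
  have hne := Subspace.biUnion_ne_univ_of_top_notMem hbad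
  obtain ⟨a, ha⟩ := (Set.ne_univ_iff_exists_notMem _).1 hne
  refine ⟨a, fun 𝔠 h𝔠 => ?_⟩
  have hQ : ∀ Q ∈ t 𝔠, ∃ n : ℕ, ∀ u, (∑ i, a i • X i) * u ∈ Q →
      u ∈ idealOfVars σ K ^ n → u ∈ Q := by
    intro Q hQ
    have hprim : Ideal.IsPrimary Q := (ht 𝔠).2 hQ
    by_cases htop : sub Q = ⊤
    · have hle : idealOfVars σ K ≤ Ideal.radical Q := by
        rw [Ideal.span_le]
        rintro _ ⟨i, rfl⟩
        have : Pi.single i (1 : K) ∈ sub Q := by rw [htop]; trivial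
        simpa [sub, lin, Fintype.linearCombination_apply_single] using this
      obtain ⟨n, hn⟩ := Ideal.exists_pow_le_of_le_radical_of_fg hle (idealOfVars_fg σ K)
      exact ⟨n, fun u _ hu => hn hu⟩
    · refine ⟨0, fun u hu _ => ?_⟩
      have hmem : sub Q ∈ bad := by
        simp only [bad, Finset.mem_filter, Finset.mem_image, Finset.mem_biUnion]
        exact ⟨⟨Q, ⟨𝔠, h𝔠, hQ⟩, rfl⟩, htop⟩
      have hnot : lin a ∉ Ideal.radical Q := fun h =>
        ha (Set.mem_biUnion (x := sub Q) hmem h)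
      rw [mul_comm] at hu
      exact ((Ideal.isPrimary_iff.1 hprim).2 hu).resolve_right hnot
  choose! n hn using hQ
  refine ⟨∑ Q ∈ t 𝔠, n Q, fun u hu hum => ?_⟩
  have hmem : ∀ v, v ∈ 𝔠 ↔ ∀ Q ∈ t 𝔠, v ∈ Q := by
    intro v
    conv_lhs => rw [← (ht 𝔠).1]
    simp [Submodule.mem_finsetInf]
  rw [hmem] at hu ⊢
  exact fun Q hQ => hn Q hQ u (hu Q hQ)
    (Ideal.pow_le_pow_right (Finset.single_le_sum (fun _ _ => Nat.zero_le _) hQ) hum)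

end LinearForms

section Graded

variable {K σ : Type*} [Field K]

theorem homogeneousComponent_mul_form {p : MvPolynomial σ K} {a : ℕ} (hp : p.IsHomogeneous a)
    (u : MvPolynomial σ K) (j : ℕ) :
    homogeneousComponent j (p * u) = if a ≤ j then p * homogeneousComponent (j - a) u else 0 := by
  classical
  have h1 : ∀ i, homogeneousComponent j (p * homogeneousComponent i u) =
      if j = a + i then p * homogeneousComponent i u else 0 := fun i =>
    homogeneousComponent_of_mem (hp.mul (homogeneousComponent_isHomogeneous i u))
  conv_lhs => rw [← sum_homogeneousComponent u, Finset.mul_sum, map_sum]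
  simp only [h1]
  split_ifs with h
  · by_cases h2 : j - a ∈ Finset.range (u.totalDegree + 1)
    · rw [Finset.sum_eq_single_of_mem _ h2, if_pos (by omega)]
      intro b _ hb
      rw [if_neg (by omega)]
    · rw [homogeneousComponent_eq_zero (j - a) u (by
        rw [Finset.mem_range] at h2; omega), mul_zero]
      refine Finset.sum_eq_zero fun i hi => if_neg ?_
      rintro rfl
      simp_all
  · exact Finset.sum_eq_zero fun i _ => if_neg (by omega)

/-- Ideals that contain the homogeneous components of their elements. -/
def Homog (𝔞 : Ideal (MvPolynomial σ K)) : Prop :=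
  ∀ u ∈ 𝔞, ∀ j, homogeneousComponent j u ∈ 𝔞

theorem Homog.top : Homog (⊤ : Ideal (MvPolynomial σ K)) := fun _ _ _ => trivial

theorem Homog.inf {𝔞 𝔟 : Ideal (MvPolynomial σ K)} (h𝔞 : Homog 𝔞) (h𝔟 : Homog 𝔟) :
    Homog (𝔞 ⊓ 𝔟) := fun u hu j => ⟨h𝔞 u hu.1 j, h𝔟 u hu.2 j⟩

theorem Homog.sup {𝔞 𝔟 : Ideal (MvPolynomial σ K)} (h𝔞 : Homog 𝔞) (h𝔟 : Homog 𝔟) :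
    Homog (𝔞 ⊔ 𝔟) := by
  intro u hu j
  obtain ⟨a, ha, b, hb, rfl⟩ := Submodule.mem_sup.1 hu
  rw [map_add]
  exact Submodule.add_mem_sup (h𝔞 a ha j) (h𝔟 b hb j)

theorem Homog.mul {𝔞 𝔟 : Ideal (MvPolynomial σ K)} (h𝔞 : Homog 𝔞) (h𝔟 : Homog 𝔟) :
    Homog (𝔞 * 𝔟) := by
  intro u hu j
  induction hu using Submodule.mul_induction_on' with
  | mem_mul_mem a ha b hb =>
    rw [← sum_homogeneousComponent a, Finset.sum_mul, map_sum]
    refine Ideal.sum_mem _ fun i _ => ?_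
    rw [homogeneousComponent_mul_form (homogeneousComponent_isHomogeneous i a)]
    split_ifs
    · exact Ideal.mul_mem_mul (h𝔞 a ha i) (h𝔟 b hb _)
    · exact zero_mem _
  | add x _ y _ hx hy => rw [map_add]; exact add_mem hx hy


theorem Homog.span {s : Set (MvPolynomial σ K)} (hs : ∀ x ∈ s, ∃ a, x.IsHomogeneous a) :
    Homog (Ideal.span s) := by
  intro u hu j
  refine Submodule.closure_induction (p := fun u _ => homogeneousComponent j u ∈ Ideal.span s)
    ?_ ?_ ?_ hu
  · simp
  · intro x y _ _ hx hy
    rw [map_add]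
    exact add_mem hx hy
  · intro r x hx
    obtain ⟨b, hb⟩ := hs x hx
    rw [smul_eq_mul, mul_comm, homogeneousComponent_mul_form hb]
    split_ifs
    · exact Ideal.mul_mem_right _ _ (Ideal.subset_span hx)
    · exact zero_mem _

theorem Homog.span_singleton {p : MvPolynomial σ K} {a : ℕ} (hp : p.IsHomogeneous a) :
    Homog (Ideal.span {p}) := Homog.span (by rintro x rfl; exact ⟨a, hp⟩)

theorem homog_idealOfVars : Homog (idealOfVars σ K) :=
  Homog.span (by rintro _ ⟨i, rfl⟩; exact ⟨1, isHomogeneous_X _ _⟩)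

/-- The colon ideal `𝔞 : (p)`. -/
def quot {R : Type*} [CommRing R] (𝔞 : Ideal R) (p : R) : Ideal R :=
  Submodule.comap (LinearMap.mulLeft R p) 𝔞

theorem mem_quot {R : Type*} [CommRing R] {𝔞 : Ideal R} {p u : R} : u ∈ quot 𝔞 p ↔ p * u ∈ 𝔞 :=
  Iff.rfl

theorem le_quot {R : Type*} [CommRing R] (𝔞 : Ideal R) (p : R) : 𝔞 ≤ quot 𝔞 p :=
  fun _ hu => mem_quot.2 (𝔞.mul_mem_left _ hu)

theorem quot_mono {R : Type*} [CommRing R] {𝔞 𝔟 : Ideal R} (h : 𝔞 ≤ 𝔟) (p : R) :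
    quot 𝔞 p ≤ quot 𝔟 p := fun _ hu => h hu

theorem RegMod.quot_eq {R : Type*} [CommRing R] {𝔞 : Ideal R} {p : R} (h : RegMod p 𝔞) :
    quot 𝔞 p = 𝔞 := le_antisymm (fun u hu => h u hu) (le_quot 𝔞 p)

theorem Homog.quot {𝔞 : Ideal (MvPolynomial σ K)} (h𝔞 : Homog 𝔞) {p : MvPolynomial σ K} {a : ℕ}
    (hp : p.IsHomogeneous a) : Homog (quot 𝔞 p) := by
  intro u hu j
  have := h𝔞 _ (mem_quot.1 hu) (j + a)
  rw [homogeneousComponent_mul_form hp, if_pos (by omega), Nat.add_sub_cancel] at this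
  exact this

/-- The forms of degree `j` in `𝔞`. -/
noncomputable def gr (𝔞 : Ideal (MvPolynomial σ K)) (j : ℕ) : Submodule K (MvPolynomial σ K) :=
  𝔞.restrictScalars K ⊓ homogeneousSubmodule σ K j

theorem mem_gr {𝔞 : Ideal (MvPolynomial σ K)} {j : ℕ} {u : MvPolynomial σ K} :
    u ∈ gr 𝔞 j ↔ u ∈ 𝔞 ∧ u.IsHomogeneous j := Iff.rfl

theorem Homog.component_mem_gr {𝔞 : Ideal (MvPolynomial σ K)} (h : Homog 𝔞)
    {u : MvPolynomial σ K} (hu : u ∈ 𝔞) (j : ℕ) : homogeneousComponent j u ∈ gr 𝔞 j :=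
  mem_gr.2 ⟨h u hu j, homogeneousComponent_isHomogeneous j u⟩

theorem Homog.le_of_gr {𝔞 𝔟 : Ideal (MvPolynomial σ K)} (h : Homog 𝔞)
    (hle : ∀ j, gr 𝔞 j ≤ 𝔟.restrictScalars K) : 𝔞 ≤ 𝔟 := by
  intro u hu
  rw [← sum_homogeneousComponent u]
  exact Ideal.sum_mem _ fun j _ => hle j (h.component_mem_gr hu j)

theorem gr_mono {𝔞 𝔟 : Ideal (MvPolynomial σ K)} (h : 𝔞 ≤ 𝔟) (j : ℕ) : gr 𝔞 j ≤ gr 𝔟 j :=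
  fun _ hu => ⟨h hu.1, hu.2⟩

theorem gr_inf (𝔞 𝔟 : Ideal (MvPolynomial σ K)) (j : ℕ) : gr (𝔞 ⊓ 𝔟) j = gr 𝔞 j ⊓ gr 𝔟 j := by
  ext u
  simp only [Submodule.mem_inf, mem_gr]
  tauto

theorem gr_sup {𝔞 𝔟 : Ideal (MvPolynomial σ K)} (h𝔞 : Homog 𝔞) (h𝔟 : Homog 𝔟) (j : ℕ) :
    gr (𝔞 ⊔ 𝔟) j = gr 𝔞 j ⊔ gr 𝔟 j := by
  refine le_antisymm ?_ (sup_le (gr_mono le_sup_left j) (gr_mono le_sup_right j))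
  rintro u ⟨hu, huj⟩
  obtain ⟨a, ha, b, hb, rfl⟩ := Submodule.mem_sup.1 hu
  rw [← homogeneousComponent_eq_self huj, map_add]
  exact Submodule.add_mem_sup (h𝔞.component_mem_gr ha j) (h𝔟.component_mem_gr hb j)

theorem Homog.span_mul {M : Ideal (MvPolynomial σ K)} (hM : Homog M) {p : MvPolynomial σ K}
    {a : ℕ} (hp : p.IsHomogeneous a) : Homog (Ideal.span {p} * M) :=
  (Homog.span_singleton hp).mul hM

theorem gr_span_mul {M : Ideal (MvPolynomial σ K)} (hM : Homog M) {p : MvPolynomial σ K}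
    {a : ℕ} (hp : p.IsHomogeneous a) (j : ℕ) :
    gr (Ideal.span {p} * M) (j + a) = (gr M j).map (LinearMap.mulLeft K p) := by
  ext u
  simp only [mem_gr, Submodule.mem_map, LinearMap.mulLeft_apply, Ideal.mem_span_singleton_mul]
  constructor
  · rintro ⟨⟨m, hm, rfl⟩, hu⟩
    refine ⟨_, mem_gr.1 (hM.component_mem_gr hm j), ?_⟩
    have := homogeneousComponent_eq_self hu
    rwa [homogeneousComponent_mul_form hp, if_pos (by omega), Nat.add_sub_cancel] at this
  · rintro ⟨m, ⟨hm, hmj⟩, rfl⟩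
    exact ⟨⟨m, hm, rfl⟩, add_comm a j ▸ hp.mul hmj⟩

theorem gr_span_mul_of_lt {M : Ideal (MvPolynomial σ K)} {p : MvPolynomial σ K}
    {a : ℕ} (hp : p.IsHomogeneous a) {j : ℕ} (hj : j < a) :
    gr (Ideal.span {p} * M) j = ⊥ := by
  rw [eq_bot_iff]
  rintro u ⟨hu, huj⟩
  obtain ⟨m, -, rfl⟩ := Ideal.mem_span_singleton_mul.1 hu
  have := homogeneousComponent_eq_self huj
  rw [homogeneousComponent_mul_form hp, if_neg (by omega)] at this
  exact this ▸ zero_mem _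

/-- The Hilbert function of an ideal. -/
noncomputable def hilb (𝔞 : Ideal (MvPolynomial σ K)) (j : ℕ) : ℤ := Module.finrank K (gr 𝔞 j)

theorem hilb_span_mul {M : Ideal (MvPolynomial σ K)} (hM : Homog M) {p : MvPolynomial σ K}
    (hp0 : p ≠ 0) {a : ℕ} (hp : p.IsHomogeneous a) (j : ℕ) :
    hilb (Ideal.span {p} * M) (j + a) = hilb M j := by
  unfold hilb
  rw [gr_span_mul hM hp]
  exact_mod_cast (Submodule.equivMapOfInjective (LinearMap.mulLeft K p)
    (mul_right_injective₀ hp0) (gr M j)).finrank_eq.symm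

theorem hilb_sup_span_of_lt {𝔞 : Ideal (MvPolynomial σ K)} (h𝔞 : Homog 𝔞)
    {p : MvPolynomial σ K} {a : ℕ} (hp : p.IsHomogeneous a) {j : ℕ} (hj : j < a) :
    hilb (𝔞 ⊔ Ideal.span {p}) j = hilb 𝔞 j := by
  unfold hilb
  rw [gr_sup h𝔞 (Homog.span_singleton hp)]
  have := gr_span_mul_of_lt (M := ⊤) hp hj
  rw [Ideal.mul_top] at this
  rw [this, sup_bot_eq]

variable [Finite σ]

instance (𝔞 : Ideal (MvPolynomial σ K)) (j : ℕ) : FiniteDimensional K (gr 𝔞 j) := by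
  have : FiniteDimensional K (homogeneousSubmodule σ K j) :=
    Module.Finite.iff_fg.2 (homogeneousSubmodule_fg σ K j)
  exact Submodule.finiteDimensional_of_le (inf_le_right : gr 𝔞 j ≤ _)

theorem hilb_mono {𝔞 𝔟 : Ideal (MvPolynomial σ K)} {j : ℕ} (h : gr 𝔞 j ≤ gr 𝔟 j) :
    hilb 𝔞 j ≤ hilb 𝔟 j := by
  unfold hilb
  exact_mod_cast Submodule.finrank_mono h

theorem hilb_mono' {𝔞 𝔟 : Ideal (MvPolynomial σ K)} (h : 𝔞 ≤ 𝔟) (j : ℕ) :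
    hilb 𝔞 j ≤ hilb 𝔟 j := hilb_mono (gr_mono h j)

theorem gr_eq_of_hilb {𝔞 𝔟 : Ideal (MvPolynomial σ K)} {j : ℕ} (h : 𝔞 ≤ 𝔟)
    (he : hilb 𝔟 j ≤ hilb 𝔞 j) : gr 𝔞 j = gr 𝔟 j :=
  Submodule.eq_of_le_of_finrank_le (gr_mono h j) (by unfold hilb at he; exact_mod_cast he)

theorem hilb_sup_add_inf {𝔞 𝔟 : Ideal (MvPolynomial σ K)} (h𝔞 : Homog 𝔞) (h𝔟 : Homog 𝔟) (j : ℕ) :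
    hilb (𝔞 ⊔ 𝔟) j + hilb (𝔞 ⊓ 𝔟) j = hilb 𝔞 j + hilb 𝔟 j := by
  unfold hilb
  rw [gr_sup h𝔞 h𝔟, gr_inf]
  exact_mod_cast Submodule.finrank_sup_add_finrank_inf_eq (gr 𝔞 j) (gr 𝔟 j)

/-- Hilbert function of `𝔞 + pM`. -/
theorem hilb_sup_span_mul {𝔞 M : Ideal (MvPolynomial σ K)} (h𝔞 : Homog 𝔞) (hM : Homog M)
    {p : MvPolynomial σ K} (hp0 : p ≠ 0) {a : ℕ} (hp : p.IsHomogeneous a) (j : ℕ) :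
    hilb (𝔞 ⊔ Ideal.span {p} * M) (j + a) + hilb (M ⊓ quot 𝔞 p) j =
      hilb 𝔞 (j + a) + hilb M j := by
  rw [← hilb_span_mul hM hp0 hp, ← hilb_sup_add_inf h𝔞 (hM.span_mul hp),
    ← hilb_span_mul (hM.inf (h𝔞.quot hp)) hp0 hp]
  congr 2
  ext u
  simp only [Ideal.mem_inf, Ideal.mem_span_singleton_mul, mem_quot]
  constructor
  · rintro ⟨m, ⟨h1, h2⟩, rfl⟩
    exact ⟨h2, m, h1, rfl⟩
  · rintro ⟨h2, m, h1, rfl⟩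
    exact ⟨m, ⟨h1, h2⟩, rfl⟩

/-- Hilbert function of `𝔞 + (p)`. -/
theorem hilb_sup_span {𝔞 : Ideal (MvPolynomial σ K)} (h𝔞 : Homog 𝔞)
    {p : MvPolynomial σ K} (hp0 : p ≠ 0) {a : ℕ} (hp : p.IsHomogeneous a) (j : ℕ) :
    hilb (𝔞 ⊔ Ideal.span {p}) (j + a) + hilb (quot 𝔞 p) j =
      hilb 𝔞 (j + a) + hilb (⊤ : Ideal (MvPolynomial σ K)) j := by
  simpa using hilb_sup_span_mul h𝔞 Homog.top hp0 hp j

end Graded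

section Saturation

/-- The saturation of an ideal with respect to the powers of `y`. -/
def sat {R : Type*} [CommRing R] (𝔠 : Ideal R) (y : R) : Ideal R where
  carrier := {u | ∃ n : ℕ, y ^ n * u ∈ 𝔠}
  add_mem' := by
    rintro u v ⟨n, hn⟩ ⟨m, hm⟩
    refine ⟨n + m, ?_⟩
    rw [show y ^ (n + m) * (u + v) = y ^ m * (y ^ n * u) + y ^ n * (y ^ m * v) by ring]
    exact 𝔠.add_mem (𝔠.mul_mem_left _ hn) (𝔠.mul_mem_left _ hm)
  zero_mem' := ⟨0, by simp⟩
  smul_mem' := by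
    rintro r u ⟨n, hn⟩
    refine ⟨n, ?_⟩
    rw [smul_eq_mul, mul_left_comm]
    exact 𝔠.mul_mem_left _ hn

theorem mem_sat {R : Type*} [CommRing R] {𝔠 : Ideal R} {y u : R} :
    u ∈ sat 𝔠 y ↔ ∃ n : ℕ, y ^ n * u ∈ 𝔠 := Iff.rfl

theorem le_sat {R : Type*} [CommRing R] (𝔠 : Ideal R) (y : R) : 𝔠 ≤ sat 𝔠 y :=
  fun u hu => mem_sat.2 ⟨0, by simpa using hu⟩

theorem regMod_sat {R : Type*} [CommRing R] (𝔠 : Ideal R) (y : R) : RegMod y (sat 𝔠 y) := by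
  rintro u ⟨n, hn⟩
  exact ⟨n + 1, by rwa [pow_succ, mul_assoc]⟩

variable {K σ : Type*} [Field K]

/-- The ideals `𝔠` and `𝔟` agree in large degrees. -/
def FinDiff (𝔠 𝔟 : Ideal (MvPolynomial σ K)) : Prop := ∃ n₀, ∀ j ≥ n₀, gr 𝔟 j ≤ gr 𝔠 j

/-- Every ideal above `𝔠` that agrees with `𝔠` in large degrees has colength at most `P` over
`𝔠`. -/
def FinDiffBound (P : ℤ) (𝔠 : Ideal (MvPolynomial σ K)) : Prop :=
  ∀ 𝔟, Homog 𝔟 → 𝔠 ≤ 𝔟 → FinDiff 𝔠 𝔟 → ∀ n, ∑ j ∈ Finset.range n, (hilb 𝔟 j - hilb 𝔠 j) ≤ P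

theorem Homog.sat {𝔠 : Ideal (MvPolynomial σ K)} (h𝔠 : Homog 𝔠) {y : MvPolynomial σ K} {a : ℕ}
    (hy : y.IsHomogeneous a) : Homog (sat 𝔠 y) := by
  rintro u ⟨n, hn⟩ j
  exact ⟨n, h𝔠.quot (hy.pow n) u hn j⟩

theorem mem_pow_idealOfVars_of_isHomogeneous {u : MvPolynomial σ K} {j n : ℕ}
    (hu : u.IsHomogeneous j) (h : n ≤ j) : u ∈ idealOfVars σ K ^ n := by
  rw [mem_pow_idealOfVars_iff']
  intro x hx
  exact hu.coeff_eq_zero (by rw [Finsupp.degree] at *; omega)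

theorem FilterReg.finDiff_sat {𝔠 : Ideal (MvPolynomial σ K)} {y : MvPolynomial σ K}
    (hy : y.IsHomogeneous 1) (h : FilterReg (idealOfVars σ K) y 𝔠) : FinDiff 𝔠 (sat 𝔠 y) := by
  obtain ⟨n₀, hn⟩ := h
  refine ⟨n₀, ?_⟩
  rintro j hj u ⟨⟨n, hu⟩, huj⟩
  refine ⟨?_, huj⟩
  induction n generalizing j u with
  | zero => simpa using hu
  | succ n ih =>
    have h1 := ih (1 + j) (by omega) (hy.mul huj) (by rwa [← mul_assoc, ← pow_succ])
    exact hn u h1 (mem_pow_idealOfVars_of_isHomogeneous huj hj)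

theorem FinDiff.le_sat {𝔠 𝔟 : Ideal (MvPolynomial σ K)} {y : MvPolynomial σ K}
    (hy : y.IsHomogeneous 1) (h𝔟 : Homog 𝔟) (h : FinDiff 𝔠 𝔟) : 𝔟 ≤ sat 𝔠 y := by
  obtain ⟨n₀, hn⟩ := h
  refine h𝔟.le_of_gr ?_
  rintro j u ⟨hu, huj⟩
  exact ⟨n₀, (hn (1 * n₀ + j) (by omega) ⟨𝔟.mul_mem_left _ hu, (hy.pow n₀).mul huj⟩).1⟩

theorem FinDiff.sup_span {𝔠 𝔟 : Ideal (MvPolynomial σ K)} {y : MvPolynomial σ K}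
    (h𝔟 : Homog 𝔟) {a : ℕ} (hy : y.IsHomogeneous a) (h : FinDiff 𝔠 𝔟) :
    FinDiff (𝔠 ⊔ Ideal.span {y}) (𝔟 ⊔ Ideal.span {y}) := by
  obtain ⟨n₀, hn⟩ := h
  refine ⟨n₀, fun j hj => ?_⟩
  rw [gr_sup h𝔟 (Homog.span_singleton hy)]
  exact sup_le ((hn j hj).trans (gr_mono le_sup_left j)) (gr_mono le_sup_right j)

variable [Finite σ]

theorem hilb_sat_succ {𝔠 : Ideal (MvPolynomial σ K)} (h𝔠 : Homog 𝔠) {y : MvPolynomial σ K}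
    (hy0 : y ≠ 0) (hy : y.IsHomogeneous 1) (j : ℕ) :
    hilb (quot 𝔠 y) j - hilb 𝔠 j =
      (hilb (sat 𝔠 y ⊔ Ideal.span {y}) (j + 1) - hilb (𝔠 ⊔ Ideal.span {y}) (j + 1)) +
      (hilb (sat 𝔠 y) j - hilb 𝔠 j) - (hilb (sat 𝔠 y) (j + 1) - hilb 𝔠 (j + 1)) := by
  have h1 := hilb_sup_span h𝔠 hy0 hy j
  have h2 := hilb_sup_span (h𝔠.sat hy) hy0 hy j
  rw [(regMod_sat 𝔠 y).quot_eq] at h2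
  linarith

theorem FinDiffBound.sum_quot_le {𝔠 : Ideal (MvPolynomial σ K)} (h𝔠 : Homog 𝔠)
    {y : MvPolynomial σ K} (hy0 : y ≠ 0) (hy : y.IsHomogeneous 1)
    (hf : FilterReg (idealOfVars σ K) y 𝔠) {P : ℤ}
    (hP : FinDiffBound P (𝔠 ⊔ Ideal.span {y})) (n : ℕ) :
    ∑ j ∈ Finset.range n, (hilb (quot 𝔠 y) j - hilb 𝔠 j) ≤ P := by
  have hb := hP (sat 𝔠 y ⊔ Ideal.span {y}) ((h𝔠.sat hy).sup (Homog.span_singleton hy))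
    (sup_le_sup_right (le_sat 𝔠 y) _) ((hf.finDiff_sat hy).sup_span (h𝔠.sat hy) hy) (n + 1)
  refine le_trans ?_ hb
  rw [Finset.sum_range_succ', hilb_sup_span_of_lt (h𝔠.sat hy) hy one_pos,
    hilb_sup_span_of_lt h𝔠 hy one_pos]
  have h1 : ∑ j ∈ Finset.range n, (hilb (quot 𝔠 y) j - hilb 𝔠 j) =
      ∑ j ∈ Finset.range n, (hilb (sat 𝔠 y ⊔ Ideal.span {y}) (j + 1) -
        hilb (𝔠 ⊔ Ideal.span {y}) (j + 1)) -
      ((hilb (sat 𝔠 y) n - hilb 𝔠 n) - (hilb (sat 𝔠 y) 0 - hilb 𝔠 0)) := by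
    rw [← Finset.sum_range_sub (fun j => hilb (sat 𝔠 y) j - hilb 𝔠 j), ← Finset.sum_sub_distrib]
    exact Finset.sum_congr rfl fun j _ => by rw [hilb_sat_succ h𝔠 hy0 hy j]; ring
  have h2 := hilb_mono' (le_sat 𝔠 y) n
  linarith

theorem FinDiffBound.of_sup_span {𝔠 : Ideal (MvPolynomial σ K)} (h𝔠 : Homog 𝔠)
    {y : MvPolynomial σ K} (hy0 : y ≠ 0) (hy : y.IsHomogeneous 1)
    (hf : FilterReg (idealOfVars σ K) y 𝔠) {P : ℤ}
    (hP : FinDiffBound P (𝔠 ⊔ Ideal.span {y})) {ρ : ℕ}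
    (hρ : ∀ j ≥ ρ, hilb (quot 𝔠 y) j = hilb 𝔠 j) : FinDiffBound (ρ * P) 𝔠 := by
  set H : ℕ → ℤ := fun j => hilb (sat 𝔠 y) j - hilb 𝔠 j with hH
  set v : ℕ → ℤ := fun j => hilb (quot 𝔠 y) j - hilb 𝔠 j with hv
  have hv0 : ∀ j, 0 ≤ v j := fun j => sub_nonneg.2 (hilb_mono' (le_quot 𝔠 y) j)
  have hH0 : ∀ j, 0 ≤ H j := fun j => sub_nonneg.2 (hilb_mono' (le_sat 𝔠 y) j)
  have hstep : ∀ j, H j ≤ v j + H (j + 1) := by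
    intro j
    have h1 := hilb_sat_succ h𝔠 hy0 hy j
    have h2 := hilb_mono' (sup_le_sup_right (le_sat 𝔠 y) (Ideal.span {y})) (j + 1)
    simp only [hH, hv]
    linarith
  have hsum : ∀ n, ∑ j ∈ Finset.range n, v j ≤ P := hP.sum_quot_le h𝔠 hy0 hy hf
  have htel : ∀ k j, H j ≤ ∑ i ∈ Finset.range k, v (j + i) + H (j + k) := by
    intro k
    induction k with
    | zero => intro j; simp
    | succ k ih =>
      intro j
      rw [Finset.sum_range_succ]
      have := ih j
      have := hstep (j + k)
      rw [add_assoc] at this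
      linarith
  obtain ⟨n₀, hn₀⟩ := hf.finDiff_sat hy
  have hHz : ∀ j ≥ n₀, H j ≤ 0 := fun j hj => sub_nonpos.2 (hilb_mono (hn₀ j hj))
  have hHP : ∀ j, H j ≤ P := by
    intro j
    have h1 := htel n₀ j
    have h2 := hHz (j + n₀) (by omega)
    have h3 := hsum (j + n₀)
    rw [Finset.sum_range_add] at h3
    have h4 : 0 ≤ ∑ i ∈ Finset.range j, v i := Finset.sum_nonneg fun i _ => hv0 i
    linarith
  have hHρ : ∀ j ≥ ρ, H j ≤ 0 := by
    intro j hj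
    have h1 := htel n₀ j
    have h2 := hHz (j + n₀) (by omega)
    have h3 : ∑ i ∈ Finset.range n₀, v (j + i) = 0 :=
      Finset.sum_eq_zero fun i _ => sub_eq_zero.2 (hρ _ (by omega))
    linarith
  intro 𝔟 h𝔟 _ hfd n
  have hle := hfd.le_sat hy h𝔟
  calc ∑ j ∈ Finset.range n, (hilb 𝔟 j - hilb 𝔠 j) ≤ ∑ j ∈ Finset.range n, H j :=
        Finset.sum_le_sum fun j _ => sub_le_sub_right (hilb_mono' hle j) _
    _ ≤ ∑ j ∈ Finset.range (ρ + n), H j :=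
        Finset.sum_le_sum_of_subset_of_nonneg (by simp) fun j _ _ => hH0 j
    _ ≤ ∑ j ∈ Finset.range ρ, P + 0 := by
        rw [Finset.sum_range_add]
        exact add_le_add (Finset.sum_le_sum fun j _ => hHP j)
          (Finset.sum_nonpos fun j _ => hHρ _ (by omega))
    _ = ρ * P := by simp

end Saturation

section Step

variable {K σ : Type*} [Field K]

theorem exists_of_mem_idealOfVars_mul [Fintype σ] {J : Ideal (MvPolynomial σ K)}
    {u : MvPolynomial σ K} (hu : u ∈ idealOfVars σ K * J) :
    ∃ m : σ → MvPolynomial σ K, (∀ i, m i ∈ J) ∧ u = ∑ i, X i * m i := by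
  induction hu using Submodule.mul_induction_on' with
  | mem_mul_mem a ha b hb =>
    obtain ⟨c, rfl⟩ := (Ideal.mem_span_range_iff_exists_fun).1 ha
    refine ⟨fun i => c i * b, fun i => J.mul_mem_left _ hb, ?_⟩
    rw [Finset.sum_mul]
    exact Finset.sum_congr rfl fun i _ => by ring
  | add x _ y _ hx hy =>
    obtain ⟨m, hm, rfl⟩ := hx
    obtain ⟨m', hm', rfl⟩ := hy
    refine ⟨fun i => m i + m' i, fun i => J.add_mem (hm i) (hm' i), ?_⟩
    rw [← Finset.sum_add_distrib]
    exact Finset.sum_congr rfl fun i _ => by ring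

theorem gr_idealOfVars_mul_succ [Fintype σ] {J : Ideal (MvPolynomial σ K)} (hJ : Homog J) (j : ℕ) :
    gr (idealOfVars σ K * J) (j + 1) ≤ ⨆ i, (gr J j).map (LinearMap.mulLeft K (X i)) := by
  rintro u ⟨hu, huj⟩
  obtain ⟨m, hm, rfl⟩ := exists_of_mem_idealOfVars_mul hu
  rw [← homogeneousComponent_eq_self huj, map_sum]
  refine Submodule.sum_mem _ fun i _ => Submodule.mem_iSup_of_mem i ?_
  rw [homogeneousComponent_mul_form (isHomogeneous_X K i), if_pos (by omega), Nat.add_sub_cancel]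
  exact ⟨_, hJ.component_mem_gr (hm i) j, rfl⟩

theorem gr_idealOfVars_mul_zero [Fintype σ] (J : Ideal (MvPolynomial σ K)) :
    gr (idealOfVars σ K * J) 0 = ⊥ := by
  rw [eq_bot_iff]
  rintro u ⟨hu, huj⟩
  obtain ⟨m, hm, rfl⟩ := exists_of_mem_idealOfVars_mul hu
  rw [← homogeneousComponent_eq_self huj, map_sum]
  refine Submodule.sum_mem _ fun i _ => ?_
  rw [homogeneousComponent_mul_form (isHomogeneous_X K i), if_neg (by omega)]
  exact zero_mem _

theorem gr_top_succ_le [Fintype σ] (j : ℕ) :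
    gr (⊤ : Ideal (MvPolynomial σ K)) (j + 1) ≤
      ⨆ i, (gr (⊤ : Ideal (MvPolynomial σ K)) j).map (LinearMap.mulLeft K (X i)) := by
  refine le_trans ?_ (gr_idealOfVars_mul_succ Homog.top j)
  rintro u ⟨-, hu⟩
  refine ⟨?_, hu⟩
  rw [Ideal.mul_top]
  simpa using mem_pow_idealOfVars_of_isHomogeneous hu (show 1 ≤ j + 1 by omega)

theorem RegMod.quot {R : Type*} [CommRing R] {I : Ideal R} {y : R} (h : RegMod y I) (f : R) :
    RegMod y (quot I f) := fun u hu => h _ (by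
  have := mem_quot.1 hu
  rwa [mul_left_comm] at this)

/-- From degree `ρ - e` on, the colon ideal `I : f` has no new generators modulo `I`. -/
def GenStop (ρ e : ℕ) (I : Ideal (MvPolynomial σ K)) (f : MvPolynomial σ K) : Prop :=
  ∀ j, ρ + 1 ≤ j + e → gr (quot I f) (j + 1) ≤
    (I ⊔ Ideal.span (gr (quot I f) j : Set (MvPolynomial σ K))).restrictScalars K

/-- The number of generators of `I : f` modulo `I` is bounded by `G`. -/
def GenBound (G : ℤ) (I : Ideal (MvPolynomial σ K)) (f : MvPolynomial σ K) : Prop :=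
  ∀ n, ∑ j ∈ Finset.range n,
    (hilb (quot I f) j - hilb (idealOfVars σ K * quot I f ⊔ I) j) ≤ G

theorem homog_span_gr (J : Ideal (MvPolynomial σ K)) (j : ℕ) :
    Homog (Ideal.span (gr J j : Set (MvPolynomial σ K))) :=
  Homog.span fun _ hx => ⟨j, hx.2⟩

theorem span_gr_le (J : Ideal (MvPolynomial σ K)) (j : ℕ) :
    Ideal.span (gr J j : Set (MvPolynomial σ K)) ≤ J :=
  Ideal.span_le.2 fun _ hx => hx.1

variable {I : Ideal (MvPolynomial σ K)} {f y : MvPolynomial σ K} {e : ℕ}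

theorem quot_sup_span_le : quot I f ⊔ Ideal.span {y} ≤ quot (I ⊔ Ideal.span {y}) f :=
  sup_le (quot_mono le_sup_left f) (le_trans le_sup_right (le_quot _ _))

/-- Comparison of the two colon ideals obtained by cutting with a hyperplane. -/
theorem hilb_quot_sup_sub [Finite σ] (hI : Homog I) (hf0 : f ≠ 0) (hf : f.IsHomogeneous (e + 1))
    (hy0 : y ≠ 0) (hy : y.IsHomogeneous 1) (hyI : RegMod y I) (j : ℕ) :
    hilb (quot (I ⊔ Ideal.span {y}) f) j - hilb (quot I f ⊔ Ideal.span {y}) j =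
      hilb (quot (I ⊔ Ideal.span {f}) y) (j + e) - hilb (I ⊔ Ideal.span {f}) (j + e) := by
  have hc := hI.sup (Homog.span_singleton hf)
  have hI' := hI.sup (Homog.span_singleton hy)
  have h1 := hilb_sup_span hc hy0 hy (j + e)
  have h2 := hilb_sup_span hI hf0 hf j
  have h3 := hilb_sup_span hI' hf0 hf j
  have h4 := hilb_sup_span hI hy0 hy (j + e)
  rw [hyI.quot_eq] at h4
  rw [sup_right_comm] at h1
  rw [← add_assoc] at h2 h3
  cases j with
  | zero =>
    have h5 := hilb_sup_span_of_lt (hI.quot hf) hy one_pos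
    have h6 := hilb_sup_span_of_lt hI hf (show 0 + e < e + 1 by omega)
    linarith
  | succ k =>
    have h5 := hilb_sup_span (hI.quot hf) hy0 hy k
    rw [(hyI.quot f).quot_eq] at h5
    have h6 := hilb_sup_span hI hf0 hf k
    rw [show k + (e + 1) = k + 1 + e by ring] at h6
    linarith

theorem GenStop.of_sup_span [Finite σ] (hI : Homog I) (hf : f.IsHomogeneous e)
    (hy : y.IsHomogeneous 1) (hyI : RegMod y I) {ρ ρ' : ℕ}
    (h : GenStop ρ e (I ⊔ Ideal.span {y}) f) (hρ : ρ ≤ ρ')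
    (hw : ∀ j, ρ' + 1 ≤ j + e → gr (quot (I ⊔ Ideal.span {y}) f) j ≤
      gr (quot I f ⊔ Ideal.span {y}) j) : GenStop ρ' e I f := by
  rintro j hj u hu
  have hJ := hI.quot hf
  set M : Ideal (MvPolynomial σ K) :=
    I ⊔ Ideal.span (gr (quot I f) j : Set (MvPolynomial σ K)) with hM
  have hMH : Homog M := hI.sup (homog_span_gr _ _)
  have hMJ : M ≤ quot I f := sup_le (le_quot I f) (span_gr_le _ _)
  have h1 := h j (by omega) (gr_mono (quot_mono le_sup_left f) _ hu)
  have h2 : (I ⊔ Ideal.span {y}) ⊔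
      Ideal.span (gr (quot (I ⊔ Ideal.span {y}) f) j : Set (MvPolynomial σ K)) ≤
      M ⊔ Ideal.span {y} := by
    refine sup_le (sup_le_sup_right le_sup_left _) (Ideal.span_le.2 fun b hb => ?_)
    have h3 := hw j hj hb
    rw [gr_sup hJ (Homog.span_singleton hy)] at h3
    obtain ⟨p, hp, q, hq, rfl⟩ := Submodule.mem_sup.1 h3
    exact Submodule.add_mem_sup (Submodule.mem_sup_right (Ideal.subset_span hp)) hq.1
  obtain ⟨a, ha, q, hq⟩ := mem_sup_span.1 (h2 h1)
  have hqJ : q ∈ quot I f := by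
    refine hyI.quot f q ?_
    rw [show y * q = u - a by rw [hq]; ring]
    exact sub_mem hu.1 (hMJ ha)
  have h4 : u = homogeneousComponent (j + 1) a + y * homogeneousComponent j q := by
    have := congrArg (homogeneousComponent (j + 1)) hq
    rwa [homogeneousComponent_eq_self hu.2, map_add, homogeneousComponent_mul_form hy,
      if_pos (by omega), Nat.add_sub_cancel] at this
  rw [h4]
  exact M.add_mem (hMH a ha _) (M.mul_mem_left _
    (Submodule.mem_sup_right (Ideal.subset_span (hJ.component_mem_gr hqJ j))))

/-- Once the cut colon ideal agrees with the colon ideal of the cut, it continues to do so. -/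
theorem GenStop.gr_succ {ρ : ℕ} (h : GenStop ρ e (I ⊔ Ideal.span {y}) f) {j : ℕ}
    (hj : ρ + 1 ≤ j + e)
    (hw : gr (quot (I ⊔ Ideal.span {y}) f) j ≤ gr (quot I f ⊔ Ideal.span {y}) j) :
    gr (quot (I ⊔ Ideal.span {y}) f) (j + 1) ≤ gr (quot I f ⊔ Ideal.span {y}) (j + 1) := by
  intro u hu
  refine ⟨?_, hu.2⟩
  refine (sup_le (sup_le_sup_right (le_quot I f) _) (Ideal.span_le.2 fun b hb => ?_)) (h j hj hu)
  exact (hw hb).1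

end Step

section Recursion

variable {K σ : Type*} [Field K] {I : Ideal (MvPolynomial σ K)} {f y : MvPolynomial σ K} {e : ℕ}

/-- The Hilbert functions of `I + (f)` and of its colon by `y` agree in large degrees. -/
theorem GenStop.hilb_quot_eq [Finite σ] (hI : Homog I) (hf0 : f ≠ 0) (hf : f.IsHomogeneous (e + 1))
    (hy0 : y ≠ 0) (hy : y.IsHomogeneous 1) (hyI : RegMod y I) {ρ P : ℕ} (he : e ≤ ρ)
    (h : GenStop ρ (e + 1) (I ⊔ Ideal.span {y}) f)
    (hP : ∀ n, ∑ j ∈ Finset.range n, (hilb (quot (I ⊔ Ideal.span {f}) y) j -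
      hilb (I ⊔ Ideal.span {f}) j) ≤ P) (j : ℕ) (hj : ρ + P ≤ j) :
    hilb (quot (I ⊔ Ideal.span {f}) y) j = hilb (I ⊔ Ideal.span {f}) j := by
  set v : ℕ → ℤ := fun j => hilb (quot (I ⊔ Ideal.span {f}) y) j - hilb (I ⊔ Ideal.span {f}) j
    with hv
  have hv0 : ∀ j, 0 ≤ v j := fun j => sub_nonneg.2 (hilb_mono' (le_quot _ y) j)
  obtain ⟨i, rfl⟩ : ∃ i, j = i + e := ⟨j - e, by omega⟩
  by_contra hne
  have hw : ∀ j, hilb (quot (I ⊔ Ideal.span {y}) f) j - hilb (quot I f ⊔ Ideal.span {y}) j =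
      v (j + e) := fun j => hilb_quot_sup_sub hI hf0 hf hy0 hy hyI j
  have hstep : ∀ k, ρ - e ≤ k → v (k + e) = 0 → v (k + 1 + e) = 0 := by
    intro k hk h0
    rw [← hw] at h0 ⊢
    have h1 := gr_eq_of_hilb (quot_sup_span_le (I := I) (f := f) (y := y)) (j := k) (by linarith)
    have h2 := h.gr_succ (by omega) h1.ge
    have h3 := hilb_mono h2
    have h4 := hilb_mono' (quot_sup_span_le (I := I) (f := f) (y := y)) (k + 1)
    linarith
  have hpos : ∀ k ∈ Finset.Ico (ρ - e) (i + 1), 1 ≤ v (k + e) := by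
    intro k hk
    rw [Finset.mem_Ico] at hk
    by_contra hlt
    have h0 : v (k + e) = 0 := by have := hv0 (k + e); omega
    have : ∀ m, k ≤ m → v (m + e) = 0 := by
      intro m hm
      induction m, hm using Nat.le_induction with
      | base => exact h0
      | succ m hm ih => exact hstep m (by omega) ih
    exact hne (sub_eq_zero.1 (this i (by omega)))
  have h1 := Finset.card_nsmul_le_sum _ _ _ hpos
  have h2 : ∑ k ∈ Finset.Ico (ρ - e) (i + 1), v (k + e) ≤ ∑ k ∈ Finset.range (i + 1), v (k + e) :=
    Finset.sum_le_sum_of_subset_of_nonneg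
      (fun x hx => Finset.mem_range.2 (Finset.mem_Ico.1 hx).2) fun k _ _ => hv0 _
  have h3 := hP (e + (i + 1))
  rw [Finset.sum_range_add] at h3
  have h4 : 0 ≤ ∑ k ∈ Finset.range e, v k := Finset.sum_nonneg fun k _ => hv0 k
  have h5 : ∑ k ∈ Finset.range (i + 1), v (k + e) = ∑ k ∈ Finset.range (i + 1), v (e + k) :=
    Finset.sum_congr rfl fun k _ => by rw [add_comm]
  simp only [Nat.card_Ico, nsmul_eq_mul, mul_one] at h1
  simp only [hv] at h1 h2 h3 h4 h5
  omega

theorem finrank_biSup_le {V ι : Type*} [AddCommGroup V] [Module K V] (s : Finset ι)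
    (A : ι → Submodule K V) [∀ i, FiniteDimensional K (A i)] :
    Module.finrank K (s.sup A : Submodule K V) ≤ ∑ i ∈ s, Module.finrank K (A i) := by
  classical
  induction s using Finset.induction_on with
  | empty => simp
  | insert a s ha ih =>
    rw [Finset.sup_insert, Finset.sum_insert ha]
    exact (Submodule.finrank_add_le_finrank_add_finrank _ _).trans (by omega)

/-- Multiplication by a linear form that is zero modulo the ideal costs one variable. -/
theorem hilb_idealOfVars_mul_succ_le [Fintype σ] {I' N J' : Ideal (MvPolynomial σ K)}
    (hI : Homog I') (hJ : Homog J') (hNJ : N ≤ J') {a : σ → K} {k : σ}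
    (hk : a k ≠ 0) (hy : ∑ i, a i • X i ∈ I') (j : ℕ) :
    hilb (idealOfVars σ K * J' ⊔ I') (j + 1) ≤ hilb (idealOfVars σ K * N ⊔ I') (j + 1) +
      (Fintype.card σ - 1 : ℕ) * (hilb J' j - hilb N j) := by
  classical
  obtain ⟨C, hC⟩ := exists_isCompl (gr N j)
  set W := C ⊓ gr J' j with hW
  have hWfin : FiniteDimensional K W :=
    Submodule.finiteDimensional_of_le (inf_le_right : W ≤ gr J' j)
  have hsup : gr J' j = gr N j ⊔ W := by
    rw [hW, ← sup_inf_assoc_of_le _ (gr_mono hNJ j), hC.sup_eq_top, top_inf_eq]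
  have hdim : (Module.finrank K W : ℤ) = hilb J' j - hilb N j := by
    have h1 := Submodule.finrank_sup_add_finrank_inf_eq (gr N j) W
    have h2 : gr N j ⊓ W = ⊥ := by
      rw [hW, ← inf_assoc, hC.inf_eq_bot, bot_inf_eq]
    rw [← hsup, h2, finrank_bot] at h1
    unfold hilb
    omega
  set F := idealOfVars σ K * N ⊔ I' with hF
  set A : σ → Submodule K (MvPolynomial σ K) := fun i => W.map (LinearMap.mulLeft K (X i)) with hA
  have hAk : ∀ i, A i ≤ gr F (j + 1) ⊔ (Finset.univ.erase k).sup A := by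
    intro i
    by_cases hik : i = k
    · subst hik
      rintro _ ⟨w, hw, rfl⟩
      have hwj : w.IsHomogeneous j := hw.2.2
      have h1 : (LinearMap.mulLeft K (X i)) w = (a i)⁻¹ • ((∑ i, a i • X i) * w) -
          ∑ l ∈ Finset.univ.erase i, ((a i)⁻¹ * a l) • (X l * w) := by
        rw [← Finset.add_sum_erase _ _ (Finset.mem_univ i), add_mul, smul_add, Finset.sum_mul,
          Finset.smul_sum]
        simp only [smul_mul_assoc, smul_smul, inv_mul_cancel₀ hk, one_smul,
          LinearMap.mulLeft_apply, add_sub_cancel_right]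
      rw [h1]
      refine Submodule.sub_mem _ (Submodule.mem_sup_left (Submodule.smul_mem _ _ ⟨?_, ?_⟩))
        (Submodule.mem_sup_right (Submodule.sum_mem _ fun l hl => Submodule.smul_mem _ _ ?_))
      · exact Submodule.mem_sup_right (I'.mul_mem_right _ hy)
      · rw [add_comm]
        refine IsHomogeneous.mul (IsHomogeneous.sum _ _ _ fun l _ => ?_) hwj
        rw [smul_eq_C_mul]
        exact isHomogeneous_C_mul_X _ _
      · exact Finset.le_sup (f := A) hl ⟨w, hw, rfl⟩
    · exact le_trans (Finset.le_sup (f := A) (by simp [hik])) le_sup_right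
  have hle : gr (idealOfVars σ K * J' ⊔ I') (j + 1) ≤
      gr F (j + 1) ⊔ (Finset.univ.erase k).sup A := by
    rw [gr_sup (homog_idealOfVars.mul hJ) hI]
    refine sup_le ((gr_idealOfVars_mul_succ hJ j).trans (iSup_le fun i => ?_))
      (le_trans (gr_mono le_sup_right _) le_sup_left)
    rw [hsup, Submodule.map_sup]
    refine sup_le (le_trans ?_ le_sup_left) (hAk i)
    rintro _ ⟨w, hw, rfl⟩
    refine ⟨Submodule.mem_sup_left (Ideal.mul_mem_mul (Ideal.subset_span ⟨i, rfl⟩) hw.1), ?_⟩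
    rw [add_comm]
    exact (isHomogeneous_X K i).mul hw.2
  have h1 := Submodule.finrank_mono hle
  have h2 := Submodule.finrank_add_le_finrank_add_finrank (gr F (j + 1))
    ((Finset.univ.erase k).sup A)
  have h3 := finrank_biSup_le (Finset.univ.erase k) A
  have h4 : ∑ i ∈ Finset.univ.erase k, Module.finrank K (A i) ≤
      (Fintype.card σ - 1) * Module.finrank K W := by
    refine (Finset.sum_le_card_nsmul _ _ _ fun i _ => Submodule.finrank_map_le _ W).trans ?_
    simp
  rw [← hdim]
  unfold hilb
  exact_mod_cast h1.trans (h2.trans (by omega))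

theorem GenBound.of_sup_span [Fintype σ] (hI : Homog I) (hf : f.IsHomogeneous e)
    {a : σ → K} (hya : ∑ i, a i • X i = y) (hy0 : y ≠ 0) (hy : y.IsHomogeneous 1)
    (hyI : RegMod y I) {G P : ℤ} (h : GenBound G (I ⊔ Ideal.span {y}) f)
    (hP : ∀ n, ∑ j ∈ Finset.range n, (hilb (quot (I ⊔ Ideal.span {y}) f) j -
      hilb (quot I f ⊔ Ideal.span {y}) j) ≤ P) :
    GenBound (G + (Fintype.card σ - 1 : ℕ) * P) I f := by
  obtain ⟨k, hk⟩ : ∃ k, a k ≠ 0 := by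
    by_contra! hcon
    exact hy0 (by simp [← hya, hcon])
  have hyH := Homog.span_singleton hy
  have hJ := hI.quot hf
  have hI' := hI.sup hyH
  have hJ' := hI'.quot hf
  have hN := hJ.sup hyH
  set J := quot I f
  set I' := I ⊔ Ideal.span {y} with hI'def
  set J' := quot I' f
  set N := J ⊔ Ideal.span {y} with hNdef
  set F := idealOfVars σ K * N ⊔ I' with hF
  set E := idealOfVars σ K * J ⊔ I with hE
  set E' := idealOfVars σ K * J' ⊔ I'
  have hFE : F ≤ E ⊔ Ideal.span {y} := by
    rw [hF, hNdef, Ideal.mul_sup]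
    refine sup_le (sup_le ?_ ?_) ?_
    · exact (le_sup_left : _ ≤ E).trans le_sup_left
    · have : idealOfVars σ K * Ideal.span {y} ≤ Ideal.span {y} := Ideal.mul_le_right
      exact this.trans le_sup_right
    · exact sup_le_sup_right (le_sup_right : I ≤ E) _
  have hEJ : E ≤ J := sup_le Ideal.mul_le_right (le_quot I f)
  have hyvars : y ∈ idealOfVars σ K := by
    simpa using mem_pow_idealOfVars_of_isHomogeneous hy (le_refl 1)
  have hJF : J ⊓ F ≤ E := by
    rintro u ⟨hu, hu'⟩
    obtain ⟨b, hb, q, rfl⟩ := mem_sup_span.1 (hFE hu')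
    have hyJ : y * q ∈ J := (Ideal.add_mem_iff_right J (hEJ hb)).1 hu
    have hq : q ∈ J := hyI.quot f q hyJ
    have hyq : y * q ∈ idealOfVars σ K * J := Ideal.mul_mem_mul hyvars hq
    exact E.add_mem hb (Submodule.mem_sup_left hyq)
  have hNJF : N ≤ J ⊔ F := sup_le le_sup_left
    (le_trans (le_trans le_sup_right le_sup_right) (le_sup_right (a := J)))
  have hFH : Homog F := (homog_idealOfVars.mul hN).sup hI'
  have h1 : ∀ j, hilb J j - hilb E j ≤ hilb N j - hilb F j := by
    intro j
    have h2 := hilb_sup_add_inf hJ hFH j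
    have h3 := hilb_mono' hJF j
    have h4 : hilb (J ⊔ F) j ≤ hilb N j := hilb_mono' (sup_le le_sup_left
      (sup_le Ideal.mul_le_right (sup_le_sup_right (le_quot I f) _))) j
    linarith
  have hNJ' : N ≤ J' := quot_sup_span_le
  have h2 : ∀ j, hilb N j ≤ hilb J' j := hilb_mono' hNJ'
  have h3 : ∀ j, hilb E' (j + 1) ≤ hilb F (j + 1) +
      (Fintype.card σ - 1 : ℕ) * (hilb J' j - hilb N j) := fun j =>
    hilb_idealOfVars_mul_succ_le hI' hJ' hNJ' hk
      (hya.symm ▸ Submodule.mem_sup_right (Ideal.mem_span_singleton_self _)) j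
  have h4 : hilb E' 0 ≤ hilb F 0 := by
    refine hilb_mono ?_
    rw [gr_sup (homog_idealOfVars.mul hJ') hI', gr_idealOfVars_mul_zero, bot_sup_eq]
    exact gr_mono le_sup_right _
  intro n
  calc ∑ j ∈ Finset.range n, (hilb J j - hilb E j)
      ≤ ∑ j ∈ Finset.range (n + 1), (hilb J j - hilb E j) :=
        Finset.sum_le_sum_of_subset_of_nonneg (by simp) fun j _ _ =>
          sub_nonneg.2 (hilb_mono' hEJ j)
    _ ≤ ∑ j ∈ Finset.range (n + 1), ((hilb J' j - hilb E' j) + (hilb E' j - hilb F j)) :=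
        Finset.sum_le_sum fun j _ => by linarith [h1 j, h2 j]
    _ = ∑ j ∈ Finset.range (n + 1), (hilb J' j - hilb E' j) +
        (∑ j ∈ Finset.range n, (hilb E' (j + 1) - hilb F (j + 1)) +
          (hilb E' 0 - hilb F 0)) := by
        rw [Finset.sum_add_distrib, Finset.sum_range_succ' (fun j => hilb E' j - hilb F j)]
    _ ≤ G + (∑ j ∈ Finset.range n, (Fintype.card σ - 1 : ℕ) * (hilb J' j - hilb N j) + 0) :=
        add_le_add (h _) (add_le_add
          (Finset.sum_le_sum fun j _ => by linarith [h3 j]) (by linarith))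
    _ ≤ G + (Fintype.card σ - 1 : ℕ) * P := by
        rw [← Finset.mul_sum, add_zero]
        exact add_le_add_right (mul_le_mul_of_nonneg_left (hP n) (by positivity)) _

end Recursion

section Main

/-- The backward difference of a sequence. -/
def diff (h : ℕ → ℤ) : ℕ → ℤ
  | 0 => h 0
  | j + 1 => h (j + 1) - h j

/-- Bounds for the degrees and for the finite colengths in the induction over the dimension. -/
def bd (ρ P : ℕ) : ℕ → ℕ × ℕ
  | 0 => (ρ, P)
  | n + 1 => ((bd ρ P n).1 + (bd ρ P n).2, ((bd ρ P n).1 + (bd ρ P n).2) * (bd ρ P n).2)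

theorem le_bd_fst (ρ P n : ℕ) : ρ ≤ (bd ρ P n).1 := by
  induction n with
  | zero => exact le_rfl
  | succ n ih => exact ih.trans (Nat.le_add_right _ _)

variable {K σ : Type*} [Field K]

/-- The Hilbert function of the quotient by an ideal. -/
noncomputable def hilbQuot (I : Ideal (MvPolynomial σ K)) (j : ℕ) : ℤ :=
  hilb (⊤ : Ideal (MvPolynomial σ K)) j - hilb I j

theorem one_notMem_idealOfVars : (1 : MvPolynomial σ K) ∉ idealOfVars σ K := by
  have := C_mem_pow_idealOfVars_iff (σ := σ) (R := K) 1 1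
  simpa using this

theorem isHomogeneous_linear [Fintype σ] (a : σ → K) :
    (∑ i, a i • X i : MvPolynomial σ K).IsHomogeneous 1 :=
  IsHomogeneous.sum _ _ _ fun i _ => by
    rw [smul_eq_C_mul]
    exact isHomogeneous_C_mul_X _ _

theorem linear_mem_idealOfVars [Fintype σ] (a : σ → K) :
    (∑ i, a i • X i : MvPolynomial σ K) ∈ idealOfVars σ K := by
  simpa using mem_pow_idealOfVars_of_isHomogeneous (isHomogeneous_linear a) (le_refl 1)

/-- Hyperplane sections of depth-positive ideals difference the Hilbert function of the quotient. -/
theorem hilbQuot_sup_span [Finite σ] {I : Ideal (MvPolynomial σ K)} {y : MvPolynomial σ K}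
    (hI : Homog I) (hy0 : y ≠ 0) (hy : y.IsHomogeneous 1) (hyI : RegMod y I) :
    hilbQuot (I ⊔ Ideal.span {y}) = diff (hilbQuot I) := by
  funext j
  cases j with
  | zero => rw [diff, hilbQuot, hilbQuot, hilb_sup_span_of_lt hI hy one_pos]
  | succ j =>
    have := hilb_sup_span hI hy0 hy j
    rw [hyI.quot_eq] at this
    rw [diff, hilbQuot, hilbQuot, hilbQuot]
    linarith

theorem le_idealOfVars_sup [Fintype σ] {I : Ideal (MvPolynomial σ K)} (h : I ≤ idealOfVars σ K)
    {y : MvPolynomial σ K} (hy : y ∈ idealOfVars σ K) : I ⊔ Ideal.span {y} ≤ idealOfVars σ K :=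
  sup_le h ((Ideal.span_singleton_le_iff_mem _).2 hy)

/-- The bounds for an ideal with an Artinian quotient. -/
theorem bounds_of_artinian [Fintype σ] {I : Ideal (MvPolynomial σ K)}
    {f : MvPolynomial σ K} {e : ℕ} (hf : f.IsHomogeneous (e + 1)) {ρ P : ℕ}
    (hP : ∀ n, ∑ j ∈ Finset.range n, hilbQuot I j ≤ P)
    (hρ : ∀ j > ρ, hilbQuot I j = 0) :
    GenBound P I f ∧ GenStop ρ (e + 1) I f ∧ FinDiffBound P (I ⊔ Ideal.span {f}) := by
  refine ⟨fun n => ?_, fun j hj => ?_, fun 𝔟 _ _ _ n => ?_⟩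
  · refine (Finset.sum_le_sum fun j _ => ?_).trans (hP n)
    exact sub_le_sub (hilb_mono' le_top j) (hilb_mono' le_sup_right j)
  · have htop : gr ⊤ j ≤ gr (quot I f) j := by
      rintro u ⟨-, hu⟩
      have h1 := gr_eq_of_hilb (le_top : I ≤ ⊤) (j := e + 1 + j)
        (sub_eq_zero.1 (hρ (e + 1 + j) (by omega))).le
      have h2 : f * u ∈ gr I (e + 1 + j) := by
        rw [h1]
        exact ⟨trivial, hf.mul hu⟩
      exact ⟨h2.1, hu⟩
    refine (gr_mono le_top _).trans ((gr_top_succ_le j).trans (iSup_le fun i => ?_))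
    rintro _ ⟨u, hu, rfl⟩
    exact Submodule.mem_sup_right (Ideal.mul_mem_left _ _ (Ideal.subset_span (htop hu)))
  · refine (Finset.sum_le_sum fun j _ => ?_).trans (hP n)
    exact sub_le_sub (hilb_mono' le_top j) (hilb_mono' le_sup_left j)

theorem bounds [Fintype σ] [Infinite K] {f : MvPolynomial σ K} (hf0 : f ≠ 0) {e : ℕ}
    (hf : f.IsHomogeneous (e + 1)) {p : ℕ → ℤ} {ρ P : ℕ}
    (hP : ∀ n, ∑ j ∈ Finset.range n, p j ≤ P) (hρ : ∀ j > ρ, p j = 0) (he : e ≤ ρ) (δ : ℕ) :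
    ∀ I : Ideal (MvPolynomial σ K), Homog I → I ≤ idealOfVars σ K →
      DepthGE (idealOfVars σ K) δ I → diff^[δ] (hilbQuot I) = p →
      GenBound (P + (Fintype.card σ - 1 : ℕ) * ∑ i ∈ Finset.range δ, ((bd ρ P i).2 : ℤ)) I f ∧
      GenStop (bd ρ P δ).1 (e + 1) I f ∧
      FinDiffBound (bd ρ P δ).2 (I ⊔ Ideal.span {f}) := by
  classical
  induction δ with
  | zero =>
    rintro I hI - - hp
    have := bounds_of_artinian hf (ρ := ρ) (P := P) (by simpa [← hp] using hP)
      (by simpa [← hp] using hρ)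
    simpa [bd] using this
  | succ δ ih =>
    intro I hI hIm hd hp
    obtain ⟨a, ha⟩ := exists_linear_filterReg {I, I ⊔ Ideal.span {f}}
    have hy := isHomogeneous_linear a
    have hym := linear_mem_idealOfVars a
    set y : MvPolynomial σ K := ∑ i, a i • X i with hydef
    have hyI : RegMod y I := hd.socleFree.regMod (ha _ (by simp))
    have hy0 : y ≠ 0 := by
      intro h0
      have := hyI 1 (by rw [h0, zero_mul]; exact zero_mem _)
      exact one_notMem_idealOfVars (hIm this)
    have hyc : FilterReg (idealOfVars σ K) y (I ⊔ Ideal.span {f}) := ha _ (by simp)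
    obtain ⟨h1, h2, h3⟩ := ih (I ⊔ Ideal.span {y}) (hI.sup (Homog.span_singleton hy))
      (le_idealOfVars_sup hIm hym)
      (DepthGE.sup_span (fun s => (exists_linear_filterReg s).imp' _ fun a ha =>
        ⟨linear_mem_idealOfVars a, ha⟩) δ I y hd hym hyI)
      (by rw [hilbQuot_sup_span hI hy0 hy hyI, ← hp]; rfl)
    rw [sup_right_comm] at h3
    have hc := hI.sup (Homog.span_singleton hf)
    have hsum := h3.sum_quot_le hc hy0 hy hyc
    have heρ := he.trans (le_bd_fst ρ P δ)
    have hvan := h2.hilb_quot_eq hI hf0 hf hy0 hy hyI heρ hsum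
    refine ⟨?_, ?_, ?_⟩
    · have := h1.of_sup_span hI hf hydef.symm hy0 hy hyI (P := (bd ρ P δ).2) (fun n => ?_)
      · rwa [Finset.sum_range_succ, mul_add, ← add_assoc]
      · simp only [hilb_quot_sup_sub hI hf0 hf hy0 hy hyI]
        have h4 := hsum (e + n)
        rw [Finset.sum_range_add] at h4
        have h5 : 0 ≤ ∑ j ∈ Finset.range e, (hilb (quot (I ⊔ Ideal.span {f}) y) j -
            hilb (I ⊔ Ideal.span {f}) j) :=
          Finset.sum_nonneg fun j _ => sub_nonneg.2 (hilb_mono' (le_quot _ y) j)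
        simp only [add_comm _ e]
        linarith
    · refine h2.of_sup_span hI hf hy hyI (Nat.le_add_right _ _) fun j hj => ?_
      have h4 := hilb_quot_sup_sub hI hf0 hf hy0 hy hyI j
      rw [hvan (j + e) (by simp only [bd] at hj; omega), sub_self] at h4
      exact (gr_eq_of_hilb quot_sup_span_le (by linarith)).ge
    · have := h3.of_sup_span hc hy0 hy hyc hvan
      simpa [bd] using this

end Main

section Segments

/-- The ideal generated by the first `k` members of a sequence. -/
def seg {R : Type*} [CommRing R] (F : ℕ → R) (k : ℕ) : Ideal R :=
  Ideal.span (F '' {i | i < k})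

theorem seg_zero {R : Type*} [CommRing R] (F : ℕ → R) : seg F 0 = ⊥ := by simp [seg]

theorem seg_succ {R : Type*} [CommRing R] (F : ℕ → R) (k : ℕ) :
    seg F (k + 1) = seg F k ⊔ Ideal.span {F k} := by
  rw [seg, seg, ← Ideal.span_union, ← Set.image_singleton, ← Set.image_union]
  congr 2
  ext i
  simp only [Set.mem_ofPred_eq, Set.mem_union, Set.mem_singleton_iff]
  omega

variable {K : Type*} [Field K] {n : ℕ}

theorem homog_seg {σ : Type*} {F : ℕ → MvPolynomial σ K} {a : ℕ → ℕ} {k : ℕ}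
    (hF : ∀ i < k, (F i).IsHomogeneous (a i)) : Homog (seg F k) :=
  Homog.span (by rintro _ ⟨i, hi, rfl⟩; exact ⟨_, hF i hi⟩)

theorem seg_le_idealOfVars {σ : Type*} {F : ℕ → MvPolynomial σ K} {k : ℕ}
    (hF : ∀ i < k, F i ∈ idealOfVars σ K) : seg F k ≤ idealOfVars σ K :=
  Ideal.span_le.2 (by rintro _ ⟨i, hi, rfl⟩; exact hF i hi)

theorem RegMod.ne_zero {σ : Type*} {I : Ideal (MvPolynomial σ K)} (hI : I ≤ idealOfVars σ K)
    {y : MvPolynomial σ K} (h : RegMod y I) : y ≠ 0 := by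
  rintro rfl
  exact one_notMem_idealOfVars (hI (h 1 (by rw [zero_mul]; exact zero_mem _)))

/-- The variables, as an infinite sequence. -/
noncomputable def varSeq (K : Type*) [Field K] (n : ℕ) (i : ℕ) : MvPolynomial (Fin n) K :=
  if h : i < n then X ⟨i, h⟩ else 0

theorem seg_varSeq (k : ℕ) :
    seg (varSeq K n) k = Ideal.span (X '' {i : Fin n | (i : ℕ) < k}) := by
  refine le_antisymm (Ideal.span_le.2 ?_) (Ideal.span_le.2 ?_)
  · rintro _ ⟨i, hi, rfl⟩
    by_cases h : i < n
    · rw [varSeq, dif_pos h]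
      exact Ideal.subset_span ⟨⟨i, h⟩, hi, rfl⟩
    · rw [varSeq, dif_neg h]
      exact zero_mem _
  · rintro _ ⟨i, hi, rfl⟩
    exact Ideal.subset_span ⟨i, hi, by rw [varSeq, dif_pos i.2]⟩

theorem seg_varSeq_self : seg (varSeq K n) n = idealOfVars (Fin n) K := by
  rw [seg_varSeq, idealOfVars]
  congr 1
  ext u
  simp

theorem regMod_varSeq {k : ℕ} (hk : k < n) : RegMod (varSeq K n k) (seg (varSeq K n) k) := by
  intro u hu
  rw [seg_varSeq] at hu ⊢
  rw [varSeq, dif_pos hk] at hu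
  rw [mem_ideal_span_X_image] at hu ⊢
  intro m hm
  obtain ⟨i, hi, hne⟩ := hu (m + Finsupp.single ⟨k, hk⟩ 1) (by
    rw [mem_support_iff, add_comm, coeff_X_mul]
    exact mem_support_iff.1 hm)
  refine ⟨i, hi, ?_⟩
  have : (⟨k, hk⟩ : Fin n) ≠ i := by
    rintro rfl
    exact lt_irrefl k hi
  simpa [Finsupp.single_eq_of_ne' this, Finsupp.single_eq_of_ne this] using hne

theorem isHomogeneous_varSeq (i : ℕ) : (varSeq K n i).IsHomogeneous 1 := by
  unfold varSeq
  split_ifs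
  · exact isHomogeneous_X _ _
  · exact isHomogeneous_zero _ _ _

theorem mem_idealOfVars {σ : Type*} {u : MvPolynomial σ K} {a : ℕ} (hu : u.IsHomogeneous a)
    (ha : 1 ≤ a) : u ∈ idealOfVars σ K := by
  simpa using mem_pow_idealOfVars_of_isHomogeneous hu ha

theorem depthGE_seg_varSeq {k : ℕ} (hk : k ≤ n) :
    DepthGE (idealOfVars (Fin n) K) k (seg (varSeq K n) (n - k)) := by
  induction k with
  | zero => trivial
  | succ k ih =>
    refine ⟨varSeq K n (n - (k + 1)), mem_idealOfVars (isHomogeneous_varSeq _) le_rfl,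
      regMod_varSeq (by omega), ?_⟩
    rw [← seg_succ, show n - (k + 1) + 1 = n - k by omega]
    exact ih (by omega)

theorem depthGE_bot : DepthGE (idealOfVars (Fin n) K) n ⊥ := by
  have := depthGE_seg_varSeq (K := K) (le_refl n)
  rwa [Nat.sub_self, seg_zero] at this

theorem depthGE_seg [Infinite K] {F : ℕ → MvPolynomial (Fin n) K} {c : ℕ}
    (hm : ∀ i < c, F i ∈ idealOfVars (Fin n) K) (hr : ∀ i < c, RegMod (F i) (seg F i))
    (hc : c ≤ n) : DepthGE (idealOfVars (Fin n) K) (n - c) (seg F c) := by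
  induction c with
  | zero => rw [seg_zero]; exact depthGE_bot
  | succ c ih =>
    have h := ih (fun i hi => hm i (by omega)) (fun i hi => hr i (by omega)) (by omega)
    rw [show n - c = n - (c + 1) + 1 by omega] at h
    rw [seg_succ]
    exact DepthGE.sup_span (fun s => (exists_linear_filterReg s).imp' _ fun a ha =>
        ⟨linear_mem_idealOfVars a, ha⟩) _ _ _ h (hm c (by omega)) (hr c (by omega))

/-- The Hilbert series of the quotient by an ideal. -/
noncomputable def hilbSeries {σ : Type*} (I : Ideal (MvPolynomial σ K)) : PowerSeries ℤ :=
  PowerSeries.mk (hilbQuot I)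

theorem hilbSeries_sup_span {σ : Type*} [Finite σ] {I : Ideal (MvPolynomial σ K)} (hI : Homog I)
    {p : MvPolynomial σ K} (hp0 : p ≠ 0) {a : ℕ} (hp : p.IsHomogeneous a) (hpI : RegMod p I) :
    hilbSeries (I ⊔ Ideal.span {p}) = (1 - PowerSeries.X ^ a) * hilbSeries I := by
  ext j
  rw [sub_mul, one_mul, map_sub, PowerSeries.coeff_X_pow_mul', hilbSeries, hilbSeries,
    PowerSeries.coeff_mk, PowerSeries.coeff_mk]
  split_ifs with h
  · obtain ⟨j, rfl⟩ := Nat.exists_eq_add_of_le' h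
    have := hilb_sup_span hI hp0 hp j
    rw [hpI.quot_eq] at this
    rw [Nat.add_sub_cancel, PowerSeries.coeff_mk, hilbQuot, hilbQuot, hilbQuot]
    linarith
  · rw [hilbQuot, hilbQuot, hilb_sup_span_of_lt hI hp (by omega), sub_zero]

theorem hilbSeries_seg {σ : Type*} [Finite σ] {F : ℕ → MvPolynomial σ K} {a : ℕ → ℕ} {c : ℕ}
    (hF : ∀ i < c, (F i).IsHomogeneous (a i)) (ha : ∀ i < c, 1 ≤ a i)
    (hr : ∀ i < c, RegMod (F i) (seg F i)) :
    hilbSeries (seg F c) =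
      (∏ i ∈ Finset.range c, (1 - PowerSeries.X ^ a i)) *
        hilbSeries (⊥ : Ideal (MvPolynomial σ K)) := by
  induction c with
  | zero => simp [seg_zero]
  | succ c ih =>
    have hm : seg F c ≤ idealOfVars σ K :=
      seg_le_idealOfVars fun i hi => mem_idealOfVars (hF i (by omega)) (ha i (by omega))
    rw [seg_succ, hilbSeries_sup_span (homog_seg fun i hi => hF i (by omega))
      ((hr c (by omega)).ne_zero hm) (hF c (by omega)) (hr c (by omega)),
      ih (fun i hi => hF i (by omega)) (fun i hi => ha i (by omega)) (fun i hi => hr i (by omega)),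
      Finset.prod_range_succ]
    ring

theorem hilbSeries_idealOfVars : hilbSeries (idealOfVars (Fin n) K) = 1 := by
  ext j
  rw [hilbSeries, PowerSeries.coeff_mk, PowerSeries.coeff_one, hilbQuot]
  split_ifs with h
  · subst h
    have h1 : gr (idealOfVars (Fin n) K) 0 = ⊥ := by
      have := gr_idealOfVars_mul_zero (⊤ : Ideal (MvPolynomial (Fin n) K))
      rwa [Ideal.mul_top] at this
    have h2 : gr (⊤ : Ideal (MvPolynomial (Fin n) K)) 0 = Submodule.span K {1} := by
      ext u
      rw [mem_gr, ← totalDegree_zero_iff_isHomogeneous, totalDegree_eq_zero_iff_eq_C,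
        Submodule.mem_span_singleton]
      constructor
      · rintro ⟨-, h⟩
        exact ⟨_, by rw [h, smul_eq_C_mul, mul_one]⟩
      · rintro ⟨r, rfl⟩
        exact ⟨trivial, by simp [smul_eq_C_mul]⟩
    rw [hilb, hilb, h1, h2, finrank_bot, finrank_span_singleton one_ne_zero]
    simp
  · rw [sub_eq_zero]
    refine le_antisymm (hilb_mono ?_) (hilb_mono' le_top j)
    rintro u ⟨-, hu⟩
    exact ⟨mem_idealOfVars hu (by omega), hu⟩

theorem one_sub_X_pow_mul_hilbSeries_bot :
    (1 - PowerSeries.X) ^ n * hilbSeries (⊥ : Ideal (MvPolynomial (Fin n) K)) = 1 := by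
  have := hilbSeries_seg (K := K) (F := varSeq K n) (a := fun _ => 1) (c := n)
    (fun i _ => isHomogeneous_varSeq i) (fun _ _ => le_rfl) (fun i hi => regMod_varSeq hi)
  rw [seg_varSeq_self, hilbSeries_idealOfVars] at this
  simpa using this.symm

theorem mk_diff (h : ℕ → ℤ) :
    PowerSeries.mk (diff h) = (1 - PowerSeries.X) * PowerSeries.mk h := by
  ext j
  rw [sub_mul, one_mul, map_sub, PowerSeries.coeff_mk, PowerSeries.coeff_mk]
  cases j with
  | zero => simp [diff]
  | succ j => simp [diff, PowerSeries.coeff_succ_X_mul]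

theorem mk_iterate_diff (δ : ℕ) (h : ℕ → ℤ) :
    PowerSeries.mk (diff^[δ] h) = (1 - PowerSeries.X) ^ δ * PowerSeries.mk h := by
  induction δ generalizing h with
  | zero => simp
  | succ δ ih => rw [Function.iterate_succ_apply, ih, mk_diff, pow_succ, mul_assoc]

/-- The numerator of the Hilbert series of a complete intersection. -/
noncomputable def numer (a : ℕ → ℕ) (c : ℕ) : Polynomial ℕ :=
  ∏ i ∈ Finset.range c, ∑ l ∈ Finset.range (a i), Polynomial.X ^ l

theorem iterate_diff_hilbQuot_seg {F : ℕ → MvPolynomial (Fin n) K} {a : ℕ → ℕ} {c : ℕ}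
    (hF : ∀ i < c, (F i).IsHomogeneous (a i)) (ha : ∀ i < c, 1 ≤ a i)
    (hr : ∀ i < c, RegMod (F i) (seg F i)) (hc : c ≤ n) :
    diff^[n - c] (hilbQuot (seg F c)) = fun j => ((numer a c).coeff j : ℤ) := by
  have h1 : PowerSeries.mk (diff^[n - c] (hilbQuot (seg F c))) =
      (((numer a c).map (Nat.castRingHom ℤ) : Polynomial ℤ) : PowerSeries ℤ) := by
    have h2 : PowerSeries.mk (hilbQuot (seg F c)) = hilbSeries (seg F c) := rfl
    have h3 : ∏ i ∈ Finset.range c, (1 - PowerSeries.X ^ a i : PowerSeries ℤ) =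
        (((numer a c).map (Nat.castRingHom ℤ) : Polynomial ℤ) : PowerSeries ℤ) *
          (1 - PowerSeries.X) ^ c := by
      rw [numer, Polynomial.map_prod, ← Polynomial.coeToPowerSeries.ringHom_apply,
        map_prod]
      conv_rhs => rw [← Finset.card_range c, ← Finset.prod_const, Finset.card_range,
        ← Finset.prod_mul_distrib]
      refine Finset.prod_congr rfl fun i _ => ?_
      rw [Polynomial.map_sum, map_sum]
      simp only [Polynomial.map_pow, Polynomial.map_X, map_pow,
        Polynomial.coeToPowerSeries.ringHom_apply, Polynomial.coe_X]
      exact (geom_sum_mul_neg _ _).symm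
    rw [mk_iterate_diff, h2, hilbSeries_seg hF ha hr, h3]
    have h4 := one_sub_X_pow_mul_hilbSeries_bot (K := K) (n := n)
    have h5 : n - c + c = n := by omega
    calc _ = (((numer a c).map (Nat.castRingHom ℤ) : Polynomial ℤ) : PowerSeries ℤ) *
          ((1 - PowerSeries.X) ^ (n - c + c) *
            hilbSeries (⊥ : Ideal (MvPolynomial (Fin n) K))) := by rw [pow_add]; ring
      _ = _ := by rw [h5, h4, mul_one]
  funext j
  have := congrArg (PowerSeries.coeff j) h1
  simpa using this

theorem sum_coeff_numer_le {a : ℕ → ℕ} {c d : ℕ} (had : ∀ i < c, a i ≤ d) (m : ℕ) :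
    ∑ j ∈ Finset.range m, ((numer a c).coeff j : ℤ) ≤ (d ^ c : ℕ) := by
  have h1 : ∑ j ∈ Finset.range m, (numer a c).coeff j ≤ (numer a c).eval 1 := by
    rw [Polynomial.eval_eq_sum_range' (n := m + ((numer a c).natDegree + 1)) (by omega)]
    simp only [one_pow, mul_one]
    exact Finset.sum_le_sum_of_subset_of_nonneg (by simp) fun _ _ _ => Nat.zero_le _
  have h2 : (numer a c).eval 1 ≤ d ^ c := by
    rw [numer, Polynomial.eval_prod]
    simp only [Polynomial.eval_finsetSum, Polynomial.eval_pow, Polynomial.eval_X, one_pow,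
      Finset.sum_const, Finset.card_range, smul_eq_mul, mul_one]
    exact (Finset.prod_le_pow_card _ _ _ fun i hi => had i (Finset.mem_range.1 hi)).trans
      (by simp)
  exact_mod_cast h1.trans h2

theorem coeff_numer_eq_zero {a : ℕ → ℕ} {c d : ℕ} (had : ∀ i < c, a i ≤ d) (j : ℕ)
    (hj : c * (d - 1) < j) : ((numer a c).coeff j : ℤ) = 0 := by
  rw [Polynomial.coeff_eq_zero_of_natDegree_lt, Nat.cast_zero]
  refine lt_of_le_of_lt ((Polynomial.natDegree_prod_le _ _).trans ?_) hj
  refine (Finset.sum_le_card_nsmul _ _ (d - 1) fun i hi => ?_).trans (by simp)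
  refine Polynomial.natDegree_sum_le_of_forall_le _ _ fun l hl => ?_
  rw [Polynomial.natDegree_X_pow]
  have := had i (Finset.mem_range.1 hi)
  rw [Finset.mem_range] at hl
  omega

/-- A regular sequence of forms is not longer than the number of variables. -/
theorem length_le {F : ℕ → MvPolynomial (Fin n) K} {a : ℕ → ℕ} {c : ℕ}
    (hF : ∀ i < c, (F i).IsHomogeneous (a i)) (ha : ∀ i < c, 1 ≤ a i)
    (hr : ∀ i < c, RegMod (F i) (seg F i)) : c ≤ n := by
  by_contra! hc
  have h := iterate_diff_hilbQuot_seg (c := n) (fun i hi => hF i (by omega))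
    (fun i hi => ha i (by omega)) (fun i hi => hr i (by omega)) le_rfl
  rw [Nat.sub_self, Function.iterate_zero, id] at h
  set k := (numer a n).natDegree + 1 with hk
  have hm : seg F n ≤ idealOfVars (Fin n) K :=
    seg_le_idealOfVars fun i hi => mem_idealOfVars (hF i (by omega)) (ha i (by omega))
  have h1 : gr (seg F n) (a n * k) = gr ⊤ (a n * k) := by
    refine gr_eq_of_hilb le_top (sub_nonpos.1 ?_)
    have h2 : hilbQuot (seg F n) (a n * k) = 0 := by
      rw [h]
      have h3 : (numer a n).natDegree < a n * k := by
        have := Nat.mul_le_mul_right k (ha n hc)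
        omega
      simp [Polynomial.coeff_eq_zero_of_natDegree_lt h3]
    exact h2.le
  have h2 : F n ^ k ∈ seg F n := by
    have : F n ^ k ∈ gr (⊤ : Ideal (MvPolynomial (Fin n) K)) (a n * k) :=
      ⟨trivial, (hF n hc).pow k⟩
    rw [← h1] at this
    exact this.1
  have h3 : ∀ m, F n ^ m ∈ seg F n → (1 : MvPolynomial (Fin n) K) ∈ seg F n := by
    intro m
    induction m with
    | zero => simp
    | succ m ih => exact fun hmem => ih (hr n hc _ (by rwa [← pow_succ']))
  exact one_notMem_idealOfVars (hm (h3 k h2))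

end Segments

section Generators

variable {K : Type*} [Field K]

/-- The bound on generators for complete intersections of dimension zero. -/
theorem genBound_of_artinian {n : ℕ} [Infinite K] {F : ℕ → MvPolynomial (Fin (n + 1)) K}
    {a : ℕ → ℕ} {d : ℕ} (hF : ∀ i < n + 1, (F i).IsHomogeneous (a i)) (ha : ∀ i < n + 1, 1 ≤ a i)
    (had : ∀ i < n + 1, a i ≤ d) (hr : ∀ i < n + 1, RegMod (F i) (seg F i))
    {f : MvPolynomial (Fin (n + 1)) K} {e : ℕ} (hf : f.IsHomogeneous e) :
    GenBound (d ^ n : ℕ) (seg F (n + 1)) f := by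
  classical
  have hF' : ∀ i < n, (F i).IsHomogeneous (a i) := fun i hi => hF i (by omega)
  have ha' : ∀ i < n, 1 ≤ a i := fun i hi => ha i (by omega)
  have hr' : ∀ i < n, RegMod (F i) (seg F i) := fun i hi => hr i (by omega)
  have hm' : ∀ i < n, F i ∈ idealOfVars (Fin (n + 1)) K := fun i hi =>
    mem_idealOfVars (hF' i hi) (ha' i hi)
  obtain ⟨b, hb⟩ := exists_linear_filterReg {seg F n}
  have hy := isHomogeneous_linear b
  have hym := linear_mem_idealOfVars b
  set y : MvPolynomial (Fin (n + 1)) K := ∑ i, b i • X i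
  have hdep := depthGE_seg hm' hr' (Nat.le_succ n)
  rw [show n.succ - n = 0 + 1 by omega] at hdep
  have hyr : RegMod y (seg F n) := hdep.socleFree.regMod (hb _ (by simp))
  have hy0 : y ≠ 0 := hyr.ne_zero (seg_le_idealOfVars hm')
  have hq : hilbQuot (seg F n ⊔ Ideal.span {y}) = fun j => ((numer a n).coeff j : ℤ) := by
    rw [hilbQuot_sup_span (homog_seg hF') hy0 hy hyr,
      ← iterate_diff_hilbQuot_seg hF' ha' hr' (Nat.le_succ n),
      show n.succ - n = 1 by omega, Function.iterate_one]
  set I := seg F (n + 1) with hIdef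
  have hI : Homog I := homog_seg hF
  have hJ := hI.quot hf
  set J := quot I f with hJdef
  have hsum : ∀ m, ∑ j ∈ Finset.range m, hilbQuot (I ⊔ Ideal.span {y}) j ≤ (d ^ n : ℕ) := by
    intro m
    refine le_trans (Finset.sum_le_sum fun j _ => ?_)
      (sum_coeff_numer_le (a := a) (fun i (hi : i < n) => had i (by omega)) m)
    rw [← congrFun hq j, hIdef, seg_succ]
    exact sub_le_sub_left (hilb_mono' (sup_le_sup_right le_sup_left _) j) _
  set E := idealOfVars (Fin (n + 1)) K * J ⊔ I
  have hyE : I ⊔ Ideal.span {y} * J ≤ E :=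
    sup_le le_sup_right (le_trans (Ideal.mul_mono_left
      ((Ideal.span_singleton_le_iff_mem _).2 hym)) le_sup_left)
  have hstep : ∀ j, hilb J (j + 1) - hilb E (j + 1) ≤
      hilbQuot (I ⊔ Ideal.span {y}) (j + 1) +
      ((hilb J (j + 1) - hilb (⊤ : Ideal (MvPolynomial (Fin (n + 1)) K)) (j + 1)) -
      (hilb J j - hilb (⊤ : Ideal (MvPolynomial (Fin (n + 1)) K)) j)) := by
    intro j
    have h1 := hilb_sup_span_mul hI hJ hy0 hy j
    have h2 := hilb_mono' hyE (j + 1)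
    have h3 := hilb_sup_span hI hy0 hy j
    have h4 := hilb_mono' (inf_le_right : J ⊓ quot I y ≤ quot I y) j
    rw [hilbQuot]
    linarith
  intro m
  refine le_trans ?_ (hsum (m + 1))
  have hEJ : E ≤ J := sup_le Ideal.mul_le_right (le_quot I f)
  refine (Finset.sum_le_sum_of_subset_of_nonneg (Finset.range_subset_range.2 (Nat.le_succ m))
    fun j _ _ => sub_nonneg.2 (hilb_mono' hEJ j)).trans ?_
  rw [Finset.sum_range_succ', Finset.sum_range_succ' (hilbQuot _)]
  have h1 := Finset.sum_le_sum fun j (_ : j ∈ Finset.range m) => hstep j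
  rw [Finset.sum_add_distrib,
    Finset.sum_range_sub (fun j =>
      hilb J j - hilb (⊤ : Ideal (MvPolynomial (Fin (n + 1)) K)) j)] at h1
  have h2 := hilb_mono' (le_top : J ≤ ⊤) m
  have h3 := hilb_mono' (le_sup_right : I ≤ E) 0
  have h4 := hilb_sup_span_of_lt hI hy one_pos
  rw [hilbQuot, h4]
  linarith

theorem exists_finset_gr {σ : Type*} [Finite σ] {E J : Ideal (MvPolynomial σ K)} (h : E ≤ J)
    (j : ℕ) : ∃ t : Finset (MvPolynomial σ K), (t.card : ℤ) = hilb J j - hilb E j ∧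
      (t : Set (MvPolynomial σ K)) ⊆ gr J j ∧
      gr J j ≤ gr E j ⊔ Submodule.span K (t : Set (MvPolynomial σ K)) := by
  classical
  obtain ⟨C, hC⟩ := exists_isCompl (gr E j)
  set W := C ⊓ gr J j with hW
  have hWfin : FiniteDimensional K W :=
    Submodule.finiteDimensional_of_le (inf_le_right : W ≤ gr J j)
  have hsup : gr J j = gr E j ⊔ W := by
    rw [hW, ← sup_inf_assoc_of_le _ (gr_mono h j), hC.sup_eq_top, top_inf_eq]
  have hdim : (Module.finrank K W : ℤ) = hilb J j - hilb E j := by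
    have h1 := Submodule.finrank_sup_add_finrank_inf_eq (gr E j) W
    have h2 : gr E j ⊓ W = ⊥ := by
      rw [hW, ← inf_assoc, hC.inf_eq_bot, bot_inf_eq]
    rw [← hsup, h2, finrank_bot] at h1
    unfold hilb
    omega
  let b := Module.finBasis K W
  refine ⟨Finset.univ.image fun i => (b i : MvPolynomial σ K), ?_, ?_, ?_⟩
  · have hinj : Function.Injective fun i => (b i : MvPolynomial σ K) :=
      Subtype.val_injective.comp b.injective
    rw [Finset.card_image_of_injective _ hinj, ← hdim]
    simp
  · simp only [Finset.coe_image, Finset.coe_univ, Set.image_univ]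
    rintro _ ⟨i, rfl⟩
    exact (b i).2.2
  · rw [hsup]
    refine sup_le_sup_left ?_ _
    have h1 := congrArg (Submodule.map W.subtype) b.span_eq
    rw [Submodule.map_span, Submodule.map_top, Submodule.range_subtype, ← Set.range_comp] at h1
    refine h1.ge.trans (Submodule.span_mono ?_)
    rintro _ ⟨i, rfl⟩
    simp

/-- Graded Nakayama: a bound for the colength of `𝔪J + I` in `J` bounds the number of generators
of `J` modulo `I`. -/
theorem exists_generators {σ : Type*} [Fintype σ] {I J : Ideal (MvPolynomial σ K)}
    (hI : Homog I) (hJ : Homog J) (hIJ : I ≤ J) {G : ℕ}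
    (hG : ∀ n, ∑ j ∈ Finset.range n, (hilb J j - hilb (idealOfVars σ K * J ⊔ I) j) ≤ G) :
    ∃ s : Finset (MvPolynomial σ K), s.card ≤ G ∧
      J = Ideal.span (s : Set (MvPolynomial σ K)) ⊔ I := by
  classical
  have hEJ : idealOfVars σ K * J ⊔ I ≤ J := sup_le Ideal.mul_le_right hIJ
  choose t htc htJ hts using exists_finset_gr hEJ
  have hmem : ∀ n, ∀ j < n, gr J j ≤ (Ideal.span
      (((Finset.range n).biUnion t : Finset (MvPolynomial σ K)) : Set (MvPolynomial σ K)) ⊔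
        I).restrictScalars K := by
    intro n j hj
    induction j with
    | zero =>
      refine (hts 0).trans (sup_le ?_ (Submodule.span_le.2 fun u hu => ?_))
      · rw [gr_sup (homog_idealOfVars.mul hJ) hI, gr_idealOfVars_mul_zero, bot_sup_eq]
        exact fun u hu => Submodule.mem_sup_right hu.1
      · exact Submodule.mem_sup_left (Ideal.subset_span
          (Finset.mem_biUnion.2 ⟨0, Finset.mem_range.2 hj, hu⟩))
    | succ j ih =>
      refine (hts (j + 1)).trans (sup_le ?_ (Submodule.span_le.2 fun u hu => ?_))
      · rw [gr_sup (homog_idealOfVars.mul hJ) hI]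
        refine sup_le ((gr_idealOfVars_mul_succ hJ j).trans (iSup_le fun i => ?_))
          fun u hu => Submodule.mem_sup_right hu.1
        rintro _ ⟨u, hu, rfl⟩
        have h1 : u ∈ Ideal.span (((Finset.range n).biUnion t : Finset (MvPolynomial σ K)) :
          Set (MvPolynomial σ K)) ⊔ I := ih (by omega) hu
        exact Ideal.mul_mem_left _ (X i) h1
      · exact Submodule.mem_sup_left (Ideal.subset_span
          (Finset.mem_biUnion.2 ⟨j + 1, Finset.mem_range.2 hj, hu⟩))
  obtain ⟨T, hT⟩ := (isNoetherianRing_iff_ideal_fg _).1 inferInstance J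
  set n := T.sup totalDegree + 1 with hn
  refine ⟨(Finset.range n).biUnion t, ?_, le_antisymm ?_ (sup_le (Ideal.span_le.2 ?_) hIJ)⟩
  · have h1 : ∑ j ∈ Finset.range n, ((t j).card : ℤ) ≤ G := by
      simpa only [htc] using hG n
    exact Finset.card_biUnion_le.trans (by exact_mod_cast h1)
  · rw [← hT]
    refine Ideal.span_le.2 fun u hu => ?_
    have huJ : u ∈ J := hT ▸ Ideal.subset_span hu
    rw [← sum_homogeneousComponent u]
    refine Ideal.sum_mem _ fun j hj => hmem n j ?_ (hJ.component_mem_gr huJ j)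
    have := Finset.le_sup (f := totalDegree) hu
    rw [Finset.mem_range] at hj
    omega
  · intro u hu
    obtain ⟨j, -, hj⟩ := Finset.mem_biUnion.1 hu
    exact (htJ j hj).1

end Generators

section Descent

variable {K L : Type*} [Field K] [Field L] [Algebra K L] {σ : Type*}

/-- The coefficientwise application of a linear functional. -/
noncomputable def proj (l : L →ₗ[K] K) : MvPolynomial σ L →ₗ[K] MvPolynomial σ K :=
  (basisMonomials σ K).repr.symm.toLinearMap ∘ₗ Finsupp.mapRange.linearMap l ∘ₗ
    (basisMonomials σ L).repr.toLinearMap.restrictScalars K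

theorem coeff_proj (l : L →ₗ[K] K) (u : MvPolynomial σ L) (m : σ →₀ ℕ) :
    coeff m (proj l u) = l (coeff m u) := by
  rfl

theorem proj_map_mul (l : L →ₗ[K] K) (p : MvPolynomial σ K) (u : MvPolynomial σ L) :
    proj l (map (algebraMap K L) p * u) = p * proj l u := by
  classical
  ext m
  rw [coeff_proj, coeff_mul, coeff_mul, map_sum]
  refine Finset.sum_congr rfl fun x _ => ?_
  rw [coeff_map, coeff_proj, ← Algebra.smul_def, map_smul, smul_eq_mul]

theorem proj_mem {𝔞 : Ideal (MvPolynomial σ K)} {u : MvPolynomial σ L}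
    (hu : u ∈ 𝔞.map (map (algebraMap K L))) (l : L →ₗ[K] K) : proj l u ∈ 𝔞 := by
  refine Submodule.span_induction (p := fun u _ => ∀ v, proj l (v * u) ∈ 𝔞) ?_ ?_ ?_ ?_ hu 1
    |> fun h => by simpa using h
  · rintro _ ⟨p, hp, rfl⟩ v
    rw [mul_comm, proj_map_mul]
    exact Ideal.mul_mem_right _ _ hp
  · intro v
    simp
  · intro x y _ _ hx hy v
    rw [mul_add, map_add]
    exact 𝔞.add_mem (hx v) (hy v)
  · intro a x _ hx v
    rw [smul_eq_mul, ← mul_assoc]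
    exact hx _

theorem exists_eq_sum_proj (u : MvPolynomial σ L) : ∃ (s : Finset L) (l : L → L →ₗ[K] K),
    u = ∑ x ∈ s, x • map (algebraMap K L) (proj (l x) u) := by
  classical
  let b := Module.Basis.ofVectorSpace K L
  have hex : ∀ x : L, ∃ l : L →ₗ[K] K, ∀ i, b i = x → l = b.coord i := by
    intro x
    by_cases h : ∃ i, b i = x
    · obtain ⟨i, hi⟩ := h
      exact ⟨b.coord i, fun j hj => by rw [b.injective (hj.trans hi.symm)]⟩
    · exact ⟨0, fun i hi => absurd ⟨i, hi⟩ h⟩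
  choose l hl using hex
  set t := u.support.biUnion fun m => (b.repr (coeff m u)).support
  refine ⟨t.image b, l, ?_⟩
  rw [Finset.sum_image b.injective.injOn]
  ext m
  rw [coeff_sum]
  simp only [coeff_smul, coeff_map, coeff_proj, hl _ _ rfl, Module.Basis.coord_apply]
  by_cases hm : m ∈ u.support
  · conv_lhs => rw [← b.linearCombination_repr (coeff m u)]
    rw [Finsupp.linearCombination_apply, Finsupp.sum_of_support_subset _
      (Finset.subset_biUnion_of_mem (fun m => (b.repr (coeff m u)).support) hm) _ (by simp)]
    refine Finset.sum_congr rfl fun i _ => ?_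
    rw [Algebra.smul_def, smul_eq_mul, mul_comm]
  · rw [notMem_support_iff.1 hm]
    simp

theorem mem_map_iff {𝔞 : Ideal (MvPolynomial σ K)} {u : MvPolynomial σ L} :
    u ∈ 𝔞.map (map (algebraMap K L)) ↔ ∀ l : L →ₗ[K] K, proj l u ∈ 𝔞 := by
  refine ⟨proj_mem, fun h => ?_⟩
  obtain ⟨s, l, hu⟩ := exists_eq_sum_proj (K := K) u
  rw [hu]
  refine Ideal.sum_mem _ fun x _ => ?_
  rw [smul_eq_C_mul]
  exact Ideal.mul_mem_left _ _ (Ideal.mem_map_of_mem _ (h _))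

theorem RegMod.map_algebraMap {p : MvPolynomial σ K} {𝔞 : Ideal (MvPolynomial σ K)}
    (h : RegMod p 𝔞) :
    RegMod (map (algebraMap K L) p) (𝔞.map (map (algebraMap K L))) := by
  intro u hu
  refine mem_map_iff.2 fun l => h _ ?_
  rw [← proj_map_mul]
  exact proj_mem hu l

theorem quot_map (𝔞 : Ideal (MvPolynomial σ K)) (p : MvPolynomial σ K) :
    quot (𝔞.map (map (algebraMap K L))) (map (algebraMap K L) p) =
      (quot 𝔞 p).map (map (algebraMap K L)) := by
  ext u
  simp only [mem_quot, mem_map_iff, proj_map_mul]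

theorem proj_isHomogeneous (l : L →ₗ[K] K) {u : MvPolynomial σ L} {j : ℕ}
    (hu : u.IsHomogeneous j) : (proj l u).IsHomogeneous j := by
  intro m hm
  refine hu fun h => hm ?_
  rw [coeff_proj, h, map_zero]

theorem hilb_map [Finite σ] (𝔞 : Ideal (MvPolynomial σ K)) (j : ℕ) :
    hilb (𝔞.map (map (algebraMap K L))) j = hilb 𝔞 j := by
  let b := Module.finBasis K (gr 𝔞 j)
  have hli : LinearIndependent L fun i => map (algebraMap K L) (b i : MvPolynomial σ K) := by
    rw [Fintype.linearIndependent_iff]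
    intro x hx i
    by_contra hi
    obtain ⟨l, hl⟩ := Module.Projective.exists_dual_ne_zero K hi
    refine hl ?_
    have hb : LinearIndependent K fun i => (b i : MvPolynomial σ K) :=
      b.linearIndependent.map' (gr 𝔞 j).subtype (Submodule.ker_subtype _)
    refine Fintype.linearIndependent_iff.1 hb (fun i => l (x i)) ?_ i
    have h1 := congrArg (proj l) hx
    rw [map_sum, map_zero] at h1
    rw [← h1]
    refine Finset.sum_congr rfl fun i _ => ?_
    ext m
    rw [coeff_proj, coeff_smul, coeff_smul, coeff_map, smul_eq_mul, smul_eq_mul,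
      mul_comm (x i), ← Algebra.smul_def, map_smul, smul_eq_mul, mul_comm]
  have hspan : Submodule.span L
      (Set.range fun i => map (algebraMap K L) (b i : MvPolynomial σ K)) =
      gr (𝔞.map (map (algebraMap K L))) j := by
    refine le_antisymm (Submodule.span_le.2 ?_) fun u hu => ?_
    · rintro _ ⟨i, rfl⟩
      exact ⟨Ideal.mem_map_of_mem _ (b i).2.1, (b i).2.2.map _⟩
    · obtain ⟨s, l, hs⟩ := exists_eq_sum_proj (K := K) u
      rw [hs]
      refine Submodule.sum_mem _ fun x _ => Submodule.smul_mem _ _ ?_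
      set v : gr 𝔞 j := ⟨proj (l x) u, proj_mem hu.1 _, proj_isHomogeneous _ hu.2⟩ with hv
      have h1 : proj (l x) u = ∑ i, b.repr v i • (b i : MvPolynomial σ K) := by
        have h2 := congrArg Subtype.val (b.sum_repr v)
        rw [AddSubmonoidClass.coe_finsetSum] at h2
        exact h2.symm
      rw [h1, map_sum]
      refine Submodule.sum_mem _ fun i _ => ?_
      rw [smul_eq_C_mul, map_mul, map_C, ← smul_eq_C_mul]
      exact Submodule.smul_mem _ _ (Submodule.subset_span ⟨i, rfl⟩)
  unfold hilb
  rw [← hspan, finrank_span_eq_card hli, Fintype.card_fin]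

theorem map_idealOfVars :
    (idealOfVars σ K).map (map (algebraMap K L)) = idealOfVars σ L := by
  rw [idealOfVars, Ideal.map_span, idealOfVars, ← Set.range_comp]
  congr 2
  funext i
  simp

theorem GenBound.of_map [Fintype σ] {G : ℤ} {I : Ideal (MvPolynomial σ K)} {f : MvPolynomial σ K}
    (h : GenBound G (I.map (map (algebraMap K L))) (map (algebraMap K L) f)) : GenBound G I f := by
  intro n
  have h1 := h n
  rw [quot_map, ← map_idealOfVars (K := K), ← Ideal.map_mul, ← Ideal.map_sup] at h1
  simpa only [hilb_map] using h1

theorem seg_map (F : ℕ → MvPolynomial σ K) (k : ℕ) :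
    seg (fun i => map (algebraMap K L) (F i)) k = (seg F k).map (map (algebraMap K L)) := by
  rw [seg, seg, Ideal.map_span, ← Set.image_comp]
  rfl

end Descent

section Numerics

theorem bd_mono {ρ ρ' P P' : ℕ} (hρ : ρ ≤ ρ') (hP : P ≤ P') (n : ℕ) :
    (bd ρ P n).1 ≤ (bd ρ' P' n).1 ∧ (bd ρ P n).2 ≤ (bd ρ' P' n).2 := by
  induction n with
  | zero => exact ⟨hρ, hP⟩
  | succ n ih =>
    simp only [bd]
    exact ⟨add_le_add ih.1 ih.2, Nat.mul_le_mul (add_le_add ih.1 ih.2) ih.2⟩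

theorem bd_bd (ρ P m n : ℕ) : bd (bd ρ P m).1 (bd ρ P m).2 n = bd ρ P (m + n) := by
  induction n with
  | zero => rfl
  | succ n ih => rw [← add_assoc, bd, bd, ih]

theorem le_bd {d : ℕ} (hd : 2 ≤ d) (n : ℕ) :
    (n + 2) * (d - 1) ≤ (bd (2 * d - 1) (d ^ 2) n).1 ∧
      d ^ (n + 2) ≤ (bd (2 * d - 1) (d ^ 2) n).2 := by
  obtain ⟨k, rfl⟩ : ∃ k, d = k + 2 := ⟨d - 2, by omega⟩
  induction n with
  | zero =>
    simp only [bd, zero_add]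
    omega
  | succ n ih =>
    obtain ⟨h1, h2⟩ := ih
    have h3 := le_bd_fst (2 * (k + 2) - 1) ((k + 2) ^ 2) n
    have h4 : k + 2 ≤ (k + 2) ^ (n + 2) := Nat.le_self_pow (by omega) _
    simp only [bd]
    refine ⟨?_, ?_⟩
    · rw [show n + 1 + 2 = (n + 2) + 1 by ring, Nat.succ_mul]
      omega
    · rw [show n + 1 + 2 = (n + 2) + 1 by ring, pow_succ']
      exact Nat.mul_le_mul (by omega) h2

theorem bd_fst_succ_le {d : ℕ} (hd : 1 ≤ d) (n : ℕ) :
    (bd (2 * d - 1) (d ^ 2) (n + 1)).1 ≤ (d ^ 2 + 2 * d - 1) ^ 2 ^ n := by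
  induction n with
  | zero =>
    simp only [bd, pow_zero, pow_one]
    omega
  | succ n ih =>
    have h3 := le_bd_fst (2 * d - 1) (d ^ 2) n
    rw [pow_succ 2, pow_mul]
    refine le_trans ?_ (Nat.pow_le_pow_left ih 2)
    rw [bd, bd]
    dsimp only
    rw [add_comm, ← Nat.mul_succ, sq (_ + _)]
    exact Nat.mul_le_mul_left _ (by omega)

theorem bd_snd_le {d : ℕ} (hd : 1 ≤ d) (n : ℕ) :
    (bd (2 * d - 1) (d ^ 2) n).2 ≤
      d ^ 2 * ∏ j ∈ Finset.range n, (d ^ 2 + 2 * d - 1) ^ 2 ^ j := by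
  induction n with
  | zero => simp [bd]
  | succ n ih =>
    have h1 := bd_fst_succ_le hd n
    have h2 : (bd (2 * d - 1) (d ^ 2) (n + 1)).2 =
      (bd (2 * d - 1) (d ^ 2) n).2 * (bd (2 * d - 1) (d ^ 2) (n + 1)).1 := mul_comm _ _
    rw [h2, Finset.prod_range_succ, ← mul_assoc]
    exact Nat.mul_le_mul ih h1

theorem sum_bd_snd_add_le {ρ P : ℕ} (hρ : 1 ≤ ρ) (hP : 1 ≤ P) (n : ℕ) :
    ∑ i ∈ Finset.range (n + 1), (bd ρ P i).2 + P ≤ 2 * (bd ρ P n).2 := by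
  have hP' : ∀ n, 1 ≤ (bd ρ P n).2 := fun n => by
    induction n with
    | zero => exact hP
    | succ n ih =>
      have := le_bd_fst ρ P n
      exact Nat.mul_pos (by omega) ih
  induction n with
  | zero =>
    simp only [bd, zero_add, Finset.sum_range_one]
    omega
  | succ n ih =>
    rw [Finset.sum_range_succ]
    have h1 := le_bd_fst ρ P n
    have h2 : 2 * (bd ρ P n).2 ≤ (bd ρ P (n + 1)).2 :=
      Nat.mul_le_mul_right _ (by have := hP' n; omega)
    omega

/-- The first bound for the number of generators, without the summand one. -/
def genNum (B d : ℕ) : ℕ :=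
  B * (d + 1) * (2 * d) * ∏ j ∈ Finset.range (B - 2), ((d ^ 2 + 2 * d - 1) ^ 2 ^ j + 1)

theorem genNum_eq (B d : ℕ) : genNum B d = B * (d + 1) * (2 * d) *
    ∏ i ∈ Finset.Icc 3 B, ((d ^ 2 + 2 * d - 1) ^ (2 ^ (i - 3)) + 1) := by
  rw [genNum, Finset.range_eq_Ico, Finset.prod_Ico_eq_prod_range,
    ← Finset.Ico_add_one_right_eq_Icc, Finset.prod_Ico_eq_prod_range]
  rw [show B + 1 - 3 = B - 2 - 0 by omega]
  congr 1
  refine Finset.prod_congr rfl fun j _ => ?_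
  rw [zero_add, Nat.add_sub_cancel_left]

theorem two_mul_prod_le_genNum (B d : ℕ) :
    2 * B * (d ^ 2 * ∏ j ∈ Finset.range (B - 2), (d ^ 2 + 2 * d - 1) ^ 2 ^ j) ≤ genNum B d := by
  rw [genNum, ← mul_assoc]
  exact Nat.mul_le_mul (by nlinarith [Nat.zero_le (B * d)])
    (Finset.prod_le_prod' fun j _ => Nat.le_succ _)

theorem two_mul_bd_le_genNum {B d : ℕ} (hd : 1 ≤ d) :
    2 * B * (bd (2 * d - 1) (d ^ 2) (B - 2)).2 ≤ genNum B d :=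
  (Nat.mul_le_mul_left _ (bd_snd_le hd _)).trans (two_mul_prod_le_genNum B d)

theorem add_le_genNum {B c d : ℕ} (hd : 2 ≤ d) (hc : 2 ≤ c) (hcB : c ≤ B) :
    c + (d ^ c + B * ∑ i ∈ Finset.range (B + 1 - c), (bd (c * (d - 1)) (d ^ c) i).2) ≤
      genNum B d := by
  obtain ⟨m, rfl⟩ : ∃ m, c = m + 2 := ⟨c - 2, by omega⟩
  obtain ⟨n, rfl⟩ : ∃ n, B = m + n + 2 := ⟨B - m - 2, by omega⟩
  have hρ : 1 ≤ (m + 2) * (d - 1) := Nat.mul_pos (by omega) (by omega)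
  have hP : m + 2 < d ^ (m + 2) := Nat.lt_pow_self (by omega)
  have h1 := sum_bd_snd_add_le hρ (P := d ^ (m + 2)) (by omega) n
  have h2 := (bd_mono (le_bd hd m).1 (le_bd hd m).2 n).2
  rw [bd_bd] at h2
  refine le_trans ?_ (two_mul_bd_le_genNum (by omega))
  rw [show m + n + 2 + 1 - (m + 2) = n + 1 by omega, show m + n + 2 - 2 = m + n by omega]
  nlinarith [Nat.zero_le ((m + n) * d ^ (m + 2))]

theorem add_pow_le_genNum {B d : ℕ} (hB : 2 ≤ B) (hd : 2 ≤ d) :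
    B + 1 + d ^ B ≤ genNum B d := by
  refine le_trans ?_ (two_mul_bd_le_genNum (by omega))
  have h1 := (le_bd hd (B - 2)).2
  rw [show B - 2 + 2 = B by omega] at h1
  have h2 : B < d ^ B := Nat.lt_pow_self (by omega)
  nlinarith

theorem le_genNum {B d : ℕ} (hd : 1 ≤ d) : B ≤ genNum B d := by
  have h1 : 1 ≤ (d + 1) * (2 * d) *
      ∏ j ∈ Finset.range (B - 2), ((d ^ 2 + 2 * d - 1) ^ 2 ^ j + 1) :=
    Nat.mul_pos (Nat.mul_pos (by omega) (by omega)) (Finset.prod_pos fun _ _ => Nat.succ_pos _)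
  calc B = B * 1 := (mul_one B).symm
    _ ≤ _ := Nat.mul_le_mul_left B h1
    _ = _ := by rw [genNum]; ring

theorem genNum_succ {B : ℕ} (hB : 2 ≤ B) (d : ℕ) :
    B * genNum (B + 1) d = (B + 1) * genNum B d * ((d ^ 2 + 2 * d - 1) ^ 2 ^ (B - 2) + 1) := by
  rw [genNum, genNum, show B + 1 - 2 = B - 2 + 1 by omega, Finset.prod_range_succ]
  ring

theorem genNum_lt_pow {d : ℕ} (hd : 1 ≤ d) (n : ℕ) :
    genNum (n + 4) d + 1 ≤ (2 * d) ^ 2 ^ (n + 3) := by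
  have hQ : d ^ 2 + 2 * d - 1 ≤ 2 * d ^ 2 := by
    obtain ⟨k, rfl⟩ : ∃ k, d = k + 1 := ⟨d - 1, by omega⟩
    rw [Nat.sub_le_iff_le_add]
    nlinarith
  induction n with
  | zero =>
    have h1 : genNum (0 + 4) d =
        8 * d * (d + 1) * (((d ^ 2 + 2 * d - 1) + 1) * ((d ^ 2 + 2 * d - 1) ^ 2 + 1)) := by
      simp only [genNum, show 0 + 4 - 2 = 2 from rfl, Finset.prod_range_succ,
        Finset.prod_range_zero, pow_zero, pow_one, one_mul, zero_add]
      ring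
    have h2 : d ^ 2 + 2 * d - 1 + 1 ≤ 3 * d ^ 2 := by nlinarith
    have h3 : 1 ≤ d ^ 4 := Nat.one_le_pow _ _ hd
    have h4 : (d ^ 2 + 2 * d - 1) ^ 2 + 1 ≤ 5 * d ^ 4 := by
      have := Nat.pow_le_pow_left hQ 2
      nlinarith
    have h5 : 8 * d * (d + 1) ≤ 16 * d ^ 2 := by nlinarith
    have h6 := Nat.mul_le_mul h5 (Nat.mul_le_mul h2 h4)
    have h7 : 1 ≤ d ^ 8 := Nat.one_le_pow _ _ hd
    rw [h1]
    calc _ ≤ 16 * d ^ 2 * (3 * d ^ 2 * (5 * d ^ 4)) + d ^ 8 := add_le_add h6 h7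
      _ = 241 * d ^ 8 := by ring
      _ ≤ 256 * d ^ 8 := Nat.mul_le_mul_right _ (by norm_num)
      _ = _ := by ring
  | succ n ih =>
    set x := (2 * d) ^ 2 ^ (n + 3) with hx
    have h1 := genNum_succ (B := n + 4) (by omega) d
    rw [show n + 4 - 2 = n + 2 by omega] at h1
    set q := (d ^ 2 + 2 * d - 1) ^ 2 ^ (n + 2) with hq
    have hx' : (2 * d) ^ 2 ^ (n + 1 + 3) = x * x := by
      rw [hx, ← pow_add]
      ring_nf
    have hqx : 16 * q ≤ x := by
      have h2 : 16 ≤ 2 ^ 2 ^ (n + 2) :=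
        Nat.pow_le_pow_right (n := 2) two_pos
          (Nat.pow_le_pow_right (n := 2) two_pos (by omega : 2 ≤ n + 2))
      have h3 : q ≤ (2 * d ^ 2) ^ 2 ^ (n + 2) := Nat.pow_le_pow_left hQ _
      calc 16 * q ≤ 2 ^ 2 ^ (n + 2) * (2 * d ^ 2) ^ 2 ^ (n + 2) := Nat.mul_le_mul h2 h3
        _ = x := by
          rw [hx, ← mul_pow, show n + 3 = (n + 2) + 1 by ring, pow_succ 2 (n + 2), mul_comm (2 ^ _),
            pow_mul]
          ring
    have hx16 : 16 ≤ x := by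
      have : 1 ≤ q := Nat.one_le_pow _ _ (by omega)
      omega
    rw [hx', show n + 1 + 4 = n + 4 + 1 by ring]
    set u := genNum (n + 4) d
    have h4 : 4 * genNum (n + 4 + 1) d ≤ 5 * u * (q + 1) := by
      refine Nat.le_of_mul_le_mul_left (?_ : (n + 4) * _ ≤ (n + 4) * _) (by omega)
      calc (n + 4) * (4 * genNum (n + 4 + 1) d) = 4 * ((n + 4 + 1) * u * (q + 1)) := by
            rw [← h1]; ring
        _ = (4 * (n + 4 + 1)) * (u * (q + 1)) := by ring
        _ ≤ (5 * (n + 4)) * (u * (q + 1)) := Nat.mul_le_mul_right _ (by omega)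
        _ = _ := by ring
    have h5 : (u + 1) * (16 * (q + 1)) ≤ x * (x + 16) := Nat.mul_le_mul ih (by omega)
    nlinarith

theorem genNum_three_lt_pow {d : ℕ} (hd : 3 ≤ d) : genNum 3 d + 1 ≤ (2 * d) ^ 2 ^ 2 := by
  obtain ⟨k, rfl⟩ : ∃ k, d = k + 3 := ⟨d - 3, by omega⟩
  have h1 : (k + 3) ^ 2 + 2 * (k + 3) - 1 + 1 = (k + 3) * (k + 5) := by
    rw [Nat.sub_add_cancel (by nlinarith)]
    ring
  have h2 : genNum 3 (k + 3) = 6 * (k + 3) * (k + 4) * ((k + 3) * (k + 5)) := by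
    rw [genNum, show 3 - 2 = 1 from rfl, Finset.prod_range_one, pow_zero, pow_one, h1]
    ring
  rw [h2]
  ring_nf
  nlinarith

theorem genNum_le_pow {B d : ℕ} (hd : 1 ≤ d) (h : 4 ≤ B ∨ (B = 3 ∧ 3 ≤ d)) :
    genNum B d + 1 ≤ (2 * d) ^ 2 ^ (B - 1) := by
  rcases h with h | ⟨rfl, h⟩
  · obtain ⟨n, rfl⟩ : ∃ n, B = n + 4 := ⟨B - 4, by omega⟩
    exact genNum_lt_pow hd n
  · exact genNum_three_lt_pow h

end Numerics

section Assembly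

/-- A finite family, extended by zero to a sequence. -/
def extendZero {R : Type*} [Zero R] {c : ℕ} (f : Fin c → R) (i : ℕ) : R :=
  if h : i < c then f ⟨i, h⟩ else 0

theorem extendZero_of_lt {R : Type*} [Zero R] {c : ℕ} (f : Fin c → R) {i : ℕ} (h : i < c) :
    extendZero f i = f ⟨i, h⟩ := dif_pos h

theorem seg_extendZero {R : Type*} [CommRing R] {c : ℕ} (f : Fin c → R) :
    seg (extendZero f) c = Ideal.span (Set.range f) := by
  rw [seg]
  congr 1
  ext x
  constructor
  · rintro ⟨i, hi, rfl⟩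
    exact ⟨⟨i, hi⟩, (extendZero_of_lt f hi).symm⟩
  · rintro ⟨i, rfl⟩
    exact ⟨i, i.2, extendZero_of_lt f i.2⟩

theorem regMod_seg_of_isWeaklyRegular {R : Type*} [CommRing R] {c : ℕ} {f : Fin c → R}
    (h : RingTheory.Sequence.IsWeaklyRegular R (List.ofFn f)) {i : ℕ} (hi : i < c) :
    RegMod (extendZero f i) (seg (extendZero f) i) := by
  have hlen : i < (List.ofFn f).length := by rwa [List.length_ofFn]
  have h1 := h.regular_mod_prev i hlen
  have h2 : (Ideal.ofList ((List.ofFn f).take i) • ⊤ : Ideal R) = seg (extendZero f) i := by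
    rw [smul_eq_mul, Ideal.mul_top, Ideal.ofList, seg]
    congr 1
    ext x
    simp only [List.mem_take_iff_getElem, List.length_ofFn, List.getElem_ofFn, Set.mem_ofPred_eq,
      Set.mem_image]
    constructor
    · rintro ⟨j, hj, rfl⟩
      exact ⟨j, by omega, extendZero_of_lt f _⟩
    · rintro ⟨j, hj, rfl⟩
      exact ⟨j, by omega, (extendZero_of_lt f _).symm⟩
  rw [h2, List.getElem_ofFn] at h1
  intro u hu
  rw [extendZero_of_lt f hi] at hu
  have h3 : f ⟨i, hi⟩ • (Submodule.Quotient.mk u : R ⧸ seg (extendZero f) i) =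
      f ⟨i, hi⟩ • 0 := by
    rw [smul_zero, ← Submodule.Quotient.mk_smul, Submodule.Quotient.mk_eq_zero]
    exact hu
  exact (Submodule.Quotient.mk_eq_zero _).1 (h1 h3)

variable {K : Type*} [Field K]

theorem exists_genBound_of_infinite [Infinite K] {B c d : ℕ} (hB : 2 ≤ B) (hc : 2 ≤ c)
    {F : ℕ → MvPolynomial (Fin (B + 1)) K} {a : ℕ → ℕ}
    (hF : ∀ i < c, (F i).IsHomogeneous (a i)) (ha : ∀ i < c, 1 ≤ a i)
    (had : ∀ i < c, a i ≤ d) (hr : ∀ i < c, RegMod (F i) (seg F i))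
    {g : MvPolynomial (Fin (B + 1)) K} (hg : g ≠ 0) {e : ℕ} (hghom : g.IsHomogeneous (e + 1))
    (he : e + 1 ≤ c * d - c) :
    ∃ G : ℕ, c + G ≤ genNum B d ∧ GenBound (G : ℤ) (seg F c) g := by
  have hd : 2 ≤ d := by
    by_contra! h
    have : c * d ≤ c * 1 := Nat.mul_le_mul_left _ (by omega)
    omega
  have hm : ∀ i < c, F i ∈ idealOfVars (Fin (B + 1)) K := fun i hi =>
    mem_idealOfVars (hF i hi) (ha i hi)
  rcases (length_le hF ha hr).eq_or_lt with rfl | hcB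
  · exact ⟨d ^ B, add_pow_le_genNum hB hd, genBound_of_artinian hF ha had hr hghom⟩
  · have h1 := (bounds hg hghom (sum_coeff_numer_le (a := a) had)
      (ρ := c * (d - 1)) (coeff_numer_eq_zero had) (by rw [Nat.mul_sub_one]; omega)
      (B + 1 - c) (seg F c) (homog_seg hF) (seg_le_idealOfVars hm)
      (depthGE_seg hm hr hcB.le) (iterate_diff_hilbQuot_seg hF ha hr hcB.le)).1
    refine ⟨_, add_le_genNum hd hc (by omega), ?_⟩
    rw [Fintype.card_fin, Nat.add_sub_cancel] at h1
    exact_mod_cast h1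

theorem exists_genBound {B c d : ℕ} (hB : 2 ≤ B) (hc : 2 ≤ c)
    {F : ℕ → MvPolynomial (Fin (B + 1)) K} {a : ℕ → ℕ}
    (hF : ∀ i < c, (F i).IsHomogeneous (a i)) (ha : ∀ i < c, 1 ≤ a i)
    (had : ∀ i < c, a i ≤ d) (hr : ∀ i < c, RegMod (F i) (seg F i))
    {g : MvPolynomial (Fin (B + 1)) K} (hg : g ≠ 0) {e : ℕ} (hghom : g.IsHomogeneous (e + 1))
    (he : e + 1 ≤ c * d - c) :
    ∃ G : ℕ, c + G ≤ genNum B d ∧ GenBound (G : ℤ) (seg F c) g := by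
  let φ := algebraMap K (AlgebraicClosure K)
  have hinf : Infinite (AlgebraicClosure K) := IsAlgClosed.instInfinite
  obtain ⟨G, hG, h⟩ := exists_genBound_of_infinite hB hc (F := fun i => map φ (F i)) (a := a)
    (fun i hi => (hF i hi).map φ) ha had
    (fun i hi => by rw [seg_map]; exact (hr i hi).map_algebraMap)
    ((map_ne_zero_iff _ (map_injective φ φ.injective)).2 hg) (hghom.map φ) he
  rw [seg_map] at h
  exact ⟨G, hG, h.of_map⟩

theorem exists_quot_span_singleton {R : Type*} [CommRing R] [IsDomain R]
    [UniqueFactorizationMonoid R] (p : R) {g : R} (hg : g ≠ 0) :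
    ∃ q, quot (Ideal.span {p}) g = Ideal.span {q} := by
  obtain ⟨g', p', m, hrel, rfl, rfl⟩ :=
    UniqueFactorizationMonoid.exists_reduced_factors g hg p
  have hm : m ≠ 0 := left_ne_zero_of_mul hg
  refine ⟨p', Ideal.ext fun u => ?_⟩
  rw [mem_quot, Ideal.mem_span_singleton, Ideal.mem_span_singleton, mul_assoc,
    mul_dvd_mul_iff_left hm]
  exact ⟨fun h => hrel.symm.dvd_of_dvd_mul_left h, fun h => h.mul_left _⟩

theorem colon_span_singleton_eq_quot {R : Type*} [CommRing R] (I : Ideal R) (g : R) :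
    Submodule.colon I (Ideal.span {g} : Ideal R) = quot I g := by
  ext u
  rw [mem_quot, Submodule.mem_colon]
  constructor
  · intro h
    rw [mul_comm]
    exact h g (Ideal.mem_span_singleton_self g)
  · intro h x hx
    obtain ⟨v, rfl⟩ := Ideal.mem_span_singleton'.1 hx
    rw [smul_eq_mul, show u * (v * g) = v * (g * u) by ring]
    exact I.mul_mem_left _ h

/-- The common source of both bounds for the number of generators of the colon ideal. -/
theorem exists_generators_quot {B d : ℕ} (hB : 2 ≤ B) (hd : 1 ≤ d) {c : ℕ} (hc : 1 ≤ c)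
    {f : Fin c → MvPolynomial (Fin (B + 1)) K}
    (hdeg : ∀ i, ∃ e : ℕ, 0 < e ∧ e ≤ d ∧ (f i).IsHomogeneous e)
    (hreg : RingTheory.Sequence.IsWeaklyRegular (MvPolynomial (Fin (B + 1)) K) (List.ofFn f))
    {g : MvPolynomial (Fin (B + 1)) K} (hg : g ≠ 0) {e : ℕ} (he : e ≤ c * d - c)
    (hghom : g.IsHomogeneous e) :
    ∃ s : Finset (MvPolynomial (Fin (B + 1)) K), s.card ≤ genNum B d + 1 ∧
      Ideal.span (s : Set (MvPolynomial (Fin (B + 1)) K)) =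
        quot (Ideal.span (Set.range f)) g := by
  classical
  choose a ha had hfa using hdeg
  set F := extendZero f with hFdef
  have hF : ∀ i < c, (F i).IsHomogeneous (extendZero a i) := fun i hi => by
    rw [hFdef, extendZero_of_lt _ hi, extendZero_of_lt _ hi]
    exact hfa _
  have ha' : ∀ i < c, 1 ≤ extendZero a i := fun i hi => by
    rw [extendZero_of_lt _ hi]
    exact ha _
  have had' : ∀ i < c, extendZero a i ≤ d := fun i hi => by
    rw [extendZero_of_lt _ hi]
    exact had _
  have hr : ∀ i < c, RegMod (F i) (seg F i) := fun i hi =>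
    regMod_seg_of_isWeaklyRegular hreg hi
  have hcard : (Finset.univ.image f).card ≤ c := Finset.card_image_le.trans (by simp)
  have hcoe : ((Finset.univ.image f : Finset (MvPolynomial (Fin (B + 1)) K)) :
      Set (MvPolynomial (Fin (B + 1)) K)) = Set.range f := by simp
  rcases Nat.eq_zero_or_pos e with rfl | he0
  · refine ⟨Finset.univ.image f, ?_, ?_⟩
    · have h1 := length_le hF ha' hr
      have h2 := le_genNum (B := B) hd
      omega
    · rw [hcoe]
      have h1 : g = C (coeff 0 g) :=
        totalDegree_eq_zero_iff_eq_C.1 (Nat.le_zero.1 hghom.totalDegree_le)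
      have h2 : coeff 0 g ≠ 0 := fun h => hg (by rw [h1, h, map_zero])
      have h3 : IsUnit g := by
        rw [h1]
        exact (IsUnit.mk0 _ h2).map C
      ext u
      rw [mem_quot, Ideal.unit_mul_mem_iff_mem _ h3]
  · obtain ⟨e, rfl⟩ : ∃ e', e = e' + 1 := ⟨e - 1, by omega⟩
    rcases hc.eq_or_lt with rfl | hc
    · obtain ⟨q, hq⟩ := exists_quot_span_singleton (f 0) hg
      refine ⟨{q}, by simp, ?_⟩
      rw [Finset.coe_singleton, ← hq, Set.range_unique]
      rfl
    · obtain ⟨G, hG, h⟩ := exists_genBound hB hc hF ha' had' hr hg hghom he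
      have hI := homog_seg hF
      obtain ⟨s, hs, hJ⟩ := exists_generators hI (hI.quot hghom) (le_quot _ g) h
      rw [hFdef, seg_extendZero] at hJ
      refine ⟨s ∪ Finset.univ.image f, ?_, ?_⟩
      · have := Finset.card_union_le s (Finset.univ.image f)
        omega
      · rw [Finset.coe_union, hcoe, Ideal.span_union, ← hJ]

end Assembly

end ColonBound

/-- Bound on the minimal number of generators of a colon ideal `I : (f)`, where
`I ⊆ K[x_1,…,x_{B+1}]` is generated by a homogeneous regular sequence of `c` forms
of degrees at most `d` and `f` is a nonzero form of degree at most `cd - c`. -/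
theorem colon_generators_bound {K : Type*} [Field K] (B d : ℕ) (hB : 2 ≤ B)
    (hd : 1 ≤ d) (c : ℕ) (hc : 1 ≤ c)
    (f : Fin c → MvPolynomial (Fin (B + 1)) K)
    (hdeg : ∀ i, ∃ e : ℕ, 0 < e ∧ e ≤ d ∧ (f i).IsHomogeneous e)
    (hreg : RingTheory.Sequence.IsRegular (MvPolynomial (Fin (B + 1)) K) (List.ofFn f))
    (I : Ideal (MvPolynomial (Fin (B + 1)) K)) (hI : I = Ideal.span (Set.range f))
    (g : MvPolynomial (Fin (B + 1)) K) (hg : g ≠ 0)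
    (e : ℕ) (he : e ≤ c * d - c) (hghom : g.IsHomogeneous e) :
    (∃ s : Finset (MvPolynomial (Fin (B + 1)) K),
        s.card ≤ B * (d + 1) * (2 * d) *
            (∏ i ∈ Finset.Icc 3 B, ((d ^ 2 + 2 * d - 1) ^ (2 ^ (i - 3)) + 1)) + 1 ∧
        Ideal.span (s : Set (MvPolynomial (Fin (B + 1)) K)) =
          Submodule.colon I (Ideal.span {g})) ∧
    ((4 ≤ B ∨ (B = 3 ∧ 3 ≤ d)) →
      ∃ s : Finset (MvPolynomial (Fin (B + 1)) K),
        s.card ≤ (2 * d) ^ (2 ^ (B - 1)) ∧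
        Ideal.span (s : Set (MvPolynomial (Fin (B + 1)) K)) =
          Submodule.colon I (Ideal.span {g})) := by
  obtain ⟨s, hs, hspan⟩ :=
    ColonBound.exists_generators_quot hB hd hc hdeg hreg.toIsWeaklyRegular hg he hghom
  rw [← hI, ← ColonBound.colon_span_singleton_eq_quot] at hspan
  exact ⟨⟨s, by rwa [← ColonBound.genNum_eq], hspan⟩,
    fun h => ⟨s, hs.trans (ColonBound.genNum_le_pow hd h), hspan⟩⟩
end

section
/- Fix d ≥ 1 and a function F: ℕ^d → ℤ_{>0}. Then every δ ∈ ℕ^d admits only finitely many F-decompositions; every sequence of successive simple F-decompositions starting from δ terminates after finitely many steps at a vector of the form n·e_1; the set {n ∈ ℕ : δ ↣ n·e_1} is finite and nonempty; and its maximum B(δ) = max{n : δ ↣ n·e_1} satisfies B(δ) ≥ |δ|. -/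
/-- `δ'` is a simple `F`-decomposition of `δ` (in some degree `i ≥ 2`):
`δ' = δ - e_i + F(δ)·(e_1 + ⋯ + e_{i-1})`.  Coordinates are indexed by `Fin d`,
where index `j` corresponds to degree `j+1`. -/
def SimpleDec {d : ℕ} (F : (Fin d → ℕ) → ℕ) (δ δ' : Fin d → ℕ) : Prop :=
  ∃ i : Fin d, 0 < (i : ℕ) ∧ 0 < δ i ∧
    δ' = fun j => if j = i then δ j - 1 else if (j : ℕ) < (i : ℕ) then δ j + F δ else δ j

/-- `δ ↣ δ'`: `δ'` is obtained from `δ` by a finite (possibly empty) sequence of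
simple `F`-decompositions. -/
def Dec {d : ℕ} (F : (Fin d → ℕ) → ℕ) : (Fin d → ℕ) → (Fin d → ℕ) → Prop :=
  Relation.ReflTransGen (SimpleDec F)

/-- The vector `n · e_1`. -/
def unitVec (d n : ℕ) : Fin d → ℕ := fun j => if (j : ℕ) = 0 then n else 0

/-- Reversing simple `F`-decompositions gives a well-founded relation: they decrease vectors
lexicographically, when coordinates are compared starting from the highest degree. -/
theorem wellFounded_flip_simpleDec {d : ℕ} (F : (Fin d → ℕ) → ℕ) :
    WellFounded (flip (SimpleDec F)) := by
  have wf : WellFounded (Pi.Lex (fun a b : Fin d => b < a)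
      (fun {_} (x y : ℕ) => x < y)) :=
    Pi.Lex.wellFounded _ fun _ => wellFounded_lt
  refine Subrelation.wf ?_ wf
  rintro x y ⟨i, -, hi, rfl⟩
  refine ⟨i, fun j hj => ?_, ?_⟩
  · have hj' : (i : ℕ) < j := hj
    simp [hj.ne', hj'.not_gt]
  · simpa using hi

/-- The simple `F`-decompositions of a vector form a finite set. -/
theorem finite_setOf_simpleDec {d : ℕ} (F : (Fin d → ℕ) → ℕ) (δ : Fin d → ℕ) :
    {δ' | SimpleDec F δ δ'}.Finite := by
  refine (Set.finite_range fun i : Fin d => fun j : Fin d =>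
    if j = i then δ j - 1 else if (j : ℕ) < (i : ℕ) then δ j + F δ else δ j).subset ?_
  rintro _ ⟨i, -, -, rfl⟩
  exact ⟨i, rfl⟩

theorem finite_setOf_dec {d : ℕ} (F : (Fin d → ℕ) → ℕ) (δ : Fin d → ℕ) :
    {δ' | Dec F δ δ'}.Finite := by
  induction δ using (wellFounded_flip_simpleDec F).induction with
  | _ δ ih =>
    refine (((finite_setOf_simpleDec F δ).biUnion ih).insert δ).subset ?_
    intro δ' h
    rcases Relation.ReflTransGen.cases_head h with rfl | ⟨ε, h₁, h₂⟩
    · exact Set.mem_insert _ _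
    · exact Set.mem_insert_of_mem _ (Set.mem_biUnion h₁ h₂)

theorem SimpleDec.sum_le {d : ℕ} {F : (Fin d → ℕ) → ℕ} (hF : ∀ δ, 0 < F δ)
    {δ δ' : Fin d → ℕ} (h : SimpleDec F δ δ') : ∑ i, δ i ≤ ∑ i, δ' i := by
  obtain ⟨i, hi, hδ, rfl⟩ := h
  let z : Fin d := ⟨0, hi.trans i.isLt⟩
  have hz : z ≠ i := fun h => hi.ne (congrArg Fin.val h)
  have key : ∑ j, (δ j + if j = z then 1 else 0) ≤
      ∑ j, ((if j = i then δ j - 1 else if (j : ℕ) < (i : ℕ) then δ j + F δ else δ j) +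
        if j = i then 1 else 0) := by
    refine Finset.sum_le_sum fun j _ => ?_
    have := hF δ
    by_cases hji : j = i
    · subst hji
      simp only [if_neg hz.symm, if_true]
      omega
    · by_cases hjz : j = z
      · subst hjz
        have : (z : ℕ) < i := hi
        simp only [if_neg hji, if_pos this, if_true]
        omega
      · simp only [if_neg hji, if_neg hjz]
        split_ifs <;> omega
  simpa [Finset.sum_add_distrib] using key

theorem Dec.sum_le {d : ℕ} {F : (Fin d → ℕ) → ℕ} (hF : ∀ δ, 0 < F δ)
    {δ δ' : Fin d → ℕ} (h : Dec F δ δ') : ∑ i, δ i ≤ ∑ i, δ' i := by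
  induction h with
  | refl => exact le_rfl
  | tail _ h ih => exact ih.trans (h.sum_le hF)

/-- A vector without simple `F`-decompositions is a multiple of the first basis vector. -/
theorem exists_eq_unitVec {d : ℕ} (hd : 1 ≤ d) {F : (Fin d → ℕ) → ℕ} {δ : Fin d → ℕ}
    (h : ∀ δ', ¬ SimpleDec F δ δ') : ∃ n, δ = unitVec d n := by
  refine ⟨δ ⟨0, hd⟩, funext fun j => ?_⟩
  by_cases hj : (j : ℕ) = 0
  · rw [unitVec, if_pos hj]
    exact congrArg δ (Fin.ext hj)
  · rw [unitVec, if_neg hj]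
    by_contra hδ
    exact h _ ⟨j, Nat.pos_of_ne_zero hj, Nat.pos_of_ne_zero hδ, rfl⟩

theorem exists_dec_unitVec {d : ℕ} (hd : 1 ≤ d) (F : (Fin d → ℕ) → ℕ) (δ : Fin d → ℕ) :
    ∃ n, Dec F δ (unitVec d n) := by
  induction δ using (wellFounded_flip_simpleDec F).induction with
  | _ δ ih =>
    by_cases h : ∃ δ', SimpleDec F δ δ'
    · obtain ⟨δ', h⟩ := h
      obtain ⟨n, hn⟩ := ih δ' h
      exact ⟨n, Relation.ReflTransGen.head h hn⟩
    · obtain ⟨n, rfl⟩ := exists_eq_unitVec hd (not_exists.mp h)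
      exact ⟨n, Relation.ReflTransGen.refl⟩

theorem unitVec_injective {d : ℕ} (hd : 1 ≤ d) : Function.Injective (unitVec d) := by
  intro m n h
  simpa [unitVec] using congrFun h ⟨0, hd⟩

theorem sum_unitVec {d : ℕ} (hd : 1 ≤ d) (n : ℕ) : ∑ i, unitVec d n i = n := by
  rw [Finset.sum_eq_single_of_mem (⟨0, hd⟩ : Fin d) (Finset.mem_univ _)]
  · simp [unitVec]
  · intro j _ hj
    exact if_neg fun h => hj (Fin.ext h)

/-- Every `δ` has finitely many `F`-decompositions; every sequence of successive
simple `F`-decompositions from `δ` terminates, and it can only terminate at a vector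
of the form `n·e_1`; the set `{n : δ ↣ n·e_1}` is finite and nonempty, and its
maximum `B(δ)` satisfies `B(δ) ≥ |δ|`. -/
theorem dec_finite_terminates (d : ℕ) (hd : 1 ≤ d) (F : (Fin d → ℕ) → ℕ)
    (hF : ∀ δ, 0 < F δ) (δ : Fin d → ℕ) :
    {δ' | Dec F δ δ'}.Finite ∧
    (¬ ∃ seq : ℕ → (Fin d → ℕ), seq 0 = δ ∧ ∀ n, SimpleDec F (seq n) (seq (n + 1))) ∧
    (∀ δ', Dec F δ δ' → (∀ δ'', ¬ SimpleDec F δ' δ'') → ∃ n, δ' = unitVec d n) ∧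
    {n : ℕ | Dec F δ (unitVec d n)}.Finite ∧
    {n : ℕ | Dec F δ (unitVec d n)}.Nonempty ∧
    ∃ B : ℕ, IsGreatest {n : ℕ | Dec F δ (unitVec d n)} B ∧ (∑ i, δ i) ≤ B := by
  have hfin : {n : ℕ | Dec F δ (unitVec d n)}.Finite :=
    (finite_setOf_dec F δ).preimage (unitVec_injective hd).injOn
  have hne : {n : ℕ | Dec F δ (unitVec d n)}.Nonempty := exists_dec_unitVec hd F δ
  refine ⟨finite_setOf_dec F δ, ?_, fun _ _ h => exists_eq_unitVec hd h, hfin, hne, ?_⟩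
  · rintro ⟨seq, -, hseq⟩
    exact (wellFounded_iff_isEmpty_descending_chain.mp
      (wellFounded_flip_simpleDec F)).false ⟨seq, hseq⟩
  · have hB := Nat.sSup_mem hne hfin.bddAbove
    refine ⟨_, ⟨hB, fun n hn => le_csSup hfin.bddAbove hn⟩, ?_⟩
    exact (Dec.sum_le hF hB).trans_eq (sum_unitVec hd _)
end

section
/- Let d ≥ 2 and let Ā: ℤ_{>0}×ℕ^d → ℤ_{>0} be ascending (weakly increasing in each coordinate) and satisfy property PAb_d: whenever V = ⊕_{i=1}^d V_i ⊆ R is a graded vector space of forms with dimension vector δ such that str(V_j) ≥ Ā(η,δ) for every 1 ≤ j ≤ d with V_j ≠ 0, every sequence of K-linearly independent forms in V is an R_η-sequence. For each η ∈ ℤ_{>0} and δ ∈ ℕ^d define B(η,δ) = max{n : δ ↣ n·e_1}, where ↣ denotes (2Ā(η,·))-decomposition. Then B satisfies property PB_d: every graded vector space V ⊆ R of forms with dimension vector δ is contained in a K-subalgebra of R generated by an R_η-sequence of homogeneous forms of degrees at most d and of length at most B(η,δ). -/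
open MvPolynomial

/-- A (Noetherian) local ring is regular iff its maximal ideal can be generated by
`ringKrullDim` many elements. -/
def IsRegularLocal (S : Type*) [CommRing S] : Prop :=
  IsNoetherianRing S ∧ IsLocalRing S ∧
    ∃ s : Finset S, (Ideal.span (s : Set S)).IsMaximal ∧
      (s.card : WithBot (WithTop ℕ)) = ringKrullDim S

/-- Serre's condition `R_η`: the localization at every prime of height at most `η`
is a regular local ring. -/
def SerreReg (η : ℕ) (S : Type*) [CommRing S] : Prop :=
  ∀ p : PrimeSpectrum S, Order.height p ≤ (η : ℕ∞) →
    IsRegularLocal (Localization.AtPrime p.asIdeal)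

/-- `y` is an `R_η`-sequence: it generates a proper ideal and the quotient by each
initial segment satisfies Serre's condition `R_η`. -/
def IsSerreSeq (η : ℕ) {S : Type*} [CommRing S] {n : ℕ} (y : Fin n → S) : Prop :=
  Ideal.span (Set.range y) ≠ ⊤ ∧
    ∀ m : ℕ, m ≤ n →
      SerreReg η (S ⧸ Ideal.span (y '' {j : Fin n | (j : ℕ) < m}))

/-- `F` has a `k`-collapse: `F = Σ_{i=1}^k f_i g_i` with all `f_i, g_i`
homogeneous of positive degree.  The strength of `F` is `≥ k` iff `F` has no
`k`-collapse. -/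
def HasCollapse {K : Type*} [CommSemiring K] {N : ℕ} (k : ℕ)
    (F : MvPolynomial (Fin N) K) : Prop :=
  ∃ f g : Fin k → MvPolynomial (Fin N) K,
    (∀ i, ∃ d > 0, (f i).IsHomogeneous d) ∧
    (∀ i, ∃ d > 0, (g i).IsHomogeneous d) ∧
    F = ∑ i, f i * g i

/-- The first coordinate does not decrease under decomposition. -/
theorem Dec.apply_zero_le {d : ℕ} {F : (Fin d → ℕ) → ℕ} {δ ε : Fin d → ℕ} (h : Dec F δ ε)
    (z : Fin d) (hz : (z : ℕ) = 0) : δ z ≤ ε z := by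
  induction h with
  | refl => exact le_rfl
  | tail _ h ih =>
    obtain ⟨i, hi, -, rfl⟩ := h
    have hzi : z ≠ i := by rintro rfl; omega
    have : (z : ℕ) < i := by omega
    simp only [hzi, this, if_true, if_false]
    omega

/-- The total dimension does not decrease under `F`-decomposition when `F` is positive. -/
theorem Dec.sum_le_sum {d : ℕ} {F : (Fin d → ℕ) → ℕ} (hF : ∀ δ, 0 < F δ) {δ ε : Fin d → ℕ}
    (h : Dec F δ ε) : ∑ i, δ i ≤ ∑ i, ε i := by
  induction h with
  | refl => exact le_rfl
  | @tail β _ _ h ih =>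
    obtain ⟨i, hi, hpos, rfl⟩ := h
    refine ih.trans ?_
    let z : Fin d := ⟨0, by omega⟩
    have hz : (z : ℕ) = 0 := rfl
    have hzi : z ≠ i := by intro h; rw [← h] at hi; omega
    rw [← Finset.add_sum_erase _ _ (Finset.mem_univ i),
      ← Finset.add_sum_erase _ _ (Finset.mem_univ i),
      ← Finset.add_sum_erase _ _ (Finset.mem_erase.2 ⟨hzi, Finset.mem_univ z⟩),
      ← Finset.add_sum_erase _ _ (Finset.mem_erase.2 ⟨hzi, Finset.mem_univ z⟩)]
    have hrest : ∑ x ∈ (Finset.univ.erase i).erase z, β x ≤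
        ∑ x ∈ (Finset.univ.erase i).erase z,
          if x = i then β x - 1 else if (x : ℕ) < i then β x + F β else β x := by
      refine Finset.sum_le_sum fun x hx => ?_
      have : x ≠ i := by simp at hx; tauto
      rw [if_neg this]
      split_ifs <;> omega
    have := hF β
    simp only [if_true, hzi, if_false, hz, hi]
    omega

/-- Decompositions of `δ` can be mimicked on any larger vector when `F` is ascending. -/
theorem Dec.exists_ge {d : ℕ} {F : (Fin d → ℕ) → ℕ} (hF : Monotone F) {δ δ' ε : Fin d → ℕ}
    (h : Dec F δ δ') (hε : δ ≤ ε) : ∃ ε', Dec F ε ε' ∧ δ' ≤ ε' := by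
  induction h with
  | refl => exact ⟨ε, .refl, hε⟩
  | @tail β _ _ h ih =>
    obtain ⟨ε', hdec, hle⟩ := ih
    obtain ⟨i, hi, hpos, rfl⟩ := h
    refine ⟨_, hdec.tail ⟨i, hi, hpos.trans_le (hle i), rfl⟩, fun j => ?_⟩
    have h1 : β j ≤ ε' j := hle j
    have h2 := hF hle
    dsimp only
    split_ifs <;> omega

theorem MvPolynomial.finite_of_forall_isHomogeneous {K : Type*} [Field K] {N n : ℕ}
    {W : Submodule K (MvPolynomial (Fin N) K)} (hW : ∀ f ∈ W, f.IsHomogeneous n) :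
    Module.Finite K W := by
  have hle : W ≤ homogeneousSubmodule (Fin N) K n := fun f hf =>
    (mem_homogeneousSubmodule n f).2 (hW f hf)
  have : Module.Finite K (homogeneousSubmodule (Fin N) K n) :=
    Module.Finite.iff_fg.2 (homogeneousSubmodule_fg (Fin N) K n)
  exact Submodule.finiteDimensional_of_le hle

/-- Spaces of forms of pairwise different degrees are independent. -/
theorem MvPolynomial.iSupIndep_of_isHomogeneous {K : Type*} [Field K] {N d : ℕ}
    {V : Fin d → Submodule K (MvPolynomial (Fin N) K)}
    (hV : ∀ i, ∀ f ∈ V i, f.IsHomogeneous ((i : ℕ) + 1)) : iSupIndep V := by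
  let := decomposition (σ := Fin N) (R := K)
  have h := (DirectSum.Decomposition.isInternal
    (homogeneousSubmodule (Fin N) K)).submodule_iSupIndep
  have hinj : Function.Injective fun i : Fin d => (i : ℕ) + 1 := fun a b hab => by
    ext; simpa using hab
  exact (h.comp hinj).mono fun i f hf => (mem_homogeneousSubmodule _ f).2 (hV i f hf)

/-- A collapse of a nonzero `G ∈ V_j` as a sum of `k` products lets one trade one dimension in
degree `j` for at most `2k` dimensions in each smaller degree, without shrinking the generated
subalgebra. -/
theorem exists_reduction_of_hasCollapse {K : Type*} [Field K] {N d k : ℕ}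
    {V : Fin d → Submodule K (MvPolynomial (Fin N) K)}
    (hV : ∀ i, ∀ f ∈ V i, f.IsHomogeneous ((i : ℕ) + 1)) {j : Fin d}
    {G : MvPolynomial (Fin N) K} (hG : G ∈ V j) (hG0 : G ≠ 0) (hc : HasCollapse k G) :
    0 < (j : ℕ) ∧ ∃ V' : Fin d → Submodule K (MvPolynomial (Fin N) K),
      (∀ i, ∀ f ∈ V' i, f.IsHomogeneous ((i : ℕ) + 1)) ∧
      (∀ i, i < j → Module.finrank K (V' i) ≤ Module.finrank K (V i) + 2 * k) ∧
      Module.finrank K (V' j) < Module.finrank K (V j) ∧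
      (∀ i, j < i → V' i = V i) ∧
      ∀ A : Subalgebra K (MvPolynomial (Fin N) K),
        (∀ i, V' i ≤ Subalgebra.toSubmodule A) → ∀ i, V i ≤ Subalgebra.toSubmodule A := by
  classical
  obtain ⟨f, g, hf, hg, hfg⟩ := hc
  choose a ha hfa using hf
  choose b hb hgb using hg
  have hterm : ∀ l, a l + b l ≠ j + 1 → homogeneousComponent (j + 1) (f l * g l) = 0 := by
    intro l hl
    rw [homogeneousComponent_of_mem ((hfa l).mul (hgb l)), if_neg (Ne.symm hl)]
  have hsum : ∑ l, homogeneousComponent (j + 1) (f l * g l) = G := by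
    rw [← map_sum, ← hfg, homogeneousComponent_of_mem (hV j G hG), if_pos rfl]
  have hfin : ∀ i, Module.Finite K (V i) := fun i => finite_of_forall_isHomogeneous (hV i)
  obtain ⟨C, hC⟩ := exists_isCompl (Submodule.span K {G})
  obtain ⟨T, hTcard, hTmem⟩ : ∃ T : Fin d → Finset (MvPolynomial (Fin N) K),
      (∀ i, (T i).card ≤ 2 * k) ∧
      ∀ i p, p ∈ T i ↔ p ∈ Finset.univ.image f ∪ Finset.univ.image g ∧
        p.IsHomogeneous ((i : ℕ) + 1) := by
    refine ⟨fun i => (Finset.univ.image f ∪ Finset.univ.image g).filter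
      fun h => h.IsHomogeneous ((i : ℕ) + 1), fun i => ?_, fun i p => Finset.mem_filter⟩
    calc _ ≤ (Finset.univ.image f ∪ Finset.univ.image g).card := Finset.card_filter_le _ _
      _ ≤ (Finset.univ.image f).card + (Finset.univ.image g).card := Finset.card_union_le _ _
      _ ≤ k + k := add_le_add
          (Finset.card_image_le.trans (by simp)) (Finset.card_image_le.trans (by simp))
      _ = 2 * k := by ring
  obtain ⟨V', hlt, heq, hgt⟩ : ∃ V' : Fin d → Submodule K (MvPolynomial (Fin N) K),
      (∀ i, i < j → V' i = V i ⊔ Submodule.span K (T i : Set _)) ∧ V' j = V j ⊓ C ∧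
      ∀ i, j < i → V' i = V i :=
    ⟨fun i => if i < j then V i ⊔ Submodule.span K (T i : Set _) else
      if i = j then V j ⊓ C else V i, fun i hi => by simp [hi], by simp,
      fun i hi => by simp [hi.not_gt, hi.ne']⟩
  refine ⟨?_, V', ?_, ?_, ?_, hgt, ?_⟩
  · by_contra h0
    refine hG0 (hsum.symm.trans (Finset.sum_eq_zero fun l _ => hterm l ?_))
    have := ha l
    have := hb l
    omega
  · intro i p hp
    rcases lt_trichotomy i j with h | rfl | h
    · rw [hlt i h] at hp
      rw [← mem_homogeneousSubmodule]
      refine (sup_le (fun q hq => ?_) (Submodule.span_le.2 fun q hq => ?_) :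
        V i ⊔ Submodule.span K (T i : Set _) ≤ homogeneousSubmodule (Fin N) K (i + 1)) hp
      · exact (mem_homogeneousSubmodule _ q).2 (hV i q hq)
      · exact (mem_homogeneousSubmodule _ q).2 ((hTmem i q).1 hq).2
    · exact hV _ p (heq ▸ hp).1
    · exact hV i p (hgt i h ▸ hp)
  · intro i hi
    rw [hlt i hi]
    have hspan : Module.finrank K (Submodule.span K (T i : Set (MvPolynomial (Fin N) K))) ≤
        (T i).card := finrank_span_finset_le_card (T i)
    have hsup := Submodule.finrank_add_le_finrank_add_finrank (V i)
      (Submodule.span K (T i : Set (MvPolynomial (Fin N) K)))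
    exact hsup.trans (add_le_add le_rfl (hspan.trans (hTcard i)))
  · rw [heq]
    refine Submodule.finrank_lt_finrank_of_lt (inf_le_left.lt_of_ne fun h => hG0 ?_)
    have hGC : G ∈ C := (h.ge hG).2
    exact (Submodule.disjoint_def.1 hC.disjoint) G (Submodule.mem_span_singleton_self G) hGC
  · intro A hA i
    have hlow : ∀ i, i < j → V i ⊔ Submodule.span K (T i : Set _) ≤ Subalgebra.toSubmodule A :=
      fun i hi => hlt i hi ▸ hA i
    have hT : ∀ p n, 0 < n → n ≤ (j : ℕ) → p.IsHomogeneous n →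
        p ∈ Finset.univ.image f ∪ Finset.univ.image g → p ∈ A := by
      intro p n hn hnj hpn hp
      refine hlow ⟨n - 1, by omega⟩ (Fin.lt_def.2 (by dsimp only; omega))
        (Submodule.mem_sup_right (Submodule.subset_span ((hTmem _ p).2 ⟨hp, ?_⟩)))
      have : n - 1 + 1 = n := by omega
      simpa only [this] using hpn
    have hGA : G ∈ A := by
      rw [← hsum]
      refine sum_mem fun l _ => ?_
      by_cases hl : a l + b l = j + 1
      · have h1 := ha l
        have h2 := hb l
        rw [homogeneousComponent_of_mem ((hfa l).mul (hgb l)), if_pos hl.symm]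
        exact mul_mem (hT _ (a l) h1 (by omega) (hfa l) (by simp))
          (hT _ (b l) h2 (by omega) (hgb l) (by simp))
      · rw [hterm l hl]
        exact zero_mem A
    rcases lt_trichotomy i j with h | rfl | h
    · exact le_sup_left.trans (hlow i h)
    · have hspan : Submodule.span K {G} ≤ V i :=
        Submodule.span_le.2 (Set.singleton_subset_iff.2 hG)
      have hdecomp : V i = Submodule.span K {G} ⊔ V i ⊓ C := by
        rw [inf_comm, ← sup_inf_assoc_of_le C hspan, hC.sup_eq_top, top_inf_eq]
      rw [hdecomp]
      exact sup_le (Submodule.span_le.2 (Set.singleton_subset_iff.2 hGA)) (heq ▸ hA i)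
    · exact hgt i h ▸ hA i

/-- A graded space of forms has a homogeneous basis. -/
theorem exists_homogeneous_basis {K : Type*} [Field K] {N d : ℕ}
    {V : Fin d → Submodule K (MvPolynomial (Fin N) K)}
    (hV : ∀ i, ∀ f ∈ V i, f.IsHomogeneous ((i : ℕ) + 1)) :
    ∃ y : Fin (∑ i, Module.finrank K (V i)) → MvPolynomial (Fin N) K,
      (∀ l, ∃ j, y l ∈ V j) ∧ LinearIndependent K y ∧
      ∀ i, V i ≤ Submodule.span K (Set.range y) := by
  have hfin : ∀ i, Module.Finite K (V i) := fun i => finite_of_forall_isHomogeneous (hV i)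
  let b := fun i => Module.finBasis K (V i)
  let e : (Σ i, Fin (Module.finrank K (V i))) ≃ Fin (∑ i, Module.finrank K (V i)) :=
    finSigmaFinEquiv
  let v : (Σ i, Fin (Module.finrank K (V i))) → MvPolynomial (Fin N) K := fun s => b s.1 s.2
  have hspan : ∀ i,
      Submodule.span K (Set.range fun l => (b i l : MvPolynomial (Fin N) K)) = V i := by
    intro i
    have := congrArg (Submodule.map (V i).subtype) (b i).span_eq
    rwa [Submodule.map_span, Submodule.map_subtype_top, ← Set.range_comp] at this
  have hv : LinearIndependent K v := by
    refine linearIndependent_iUnion_finite (f := fun i l => (b i l : MvPolynomial (Fin N) K))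
      (fun i => (b i).linearIndependent.map' (V i).subtype (Submodule.ker_subtype _)) ?_
    intro i t _ hit
    simp only [hspan]
    exact (iSupIndep_of_isHomogeneous hV).disjoint_biSup hit
  refine ⟨v ∘ e.symm, fun l => ⟨_, (b (e.symm l).1 (e.symm l).2).2⟩,
    hv.comp _ e.symm.injective, fun i => ?_⟩
  rw [← hspan i, e.symm.surjective.range_comp]
  refine Submodule.span_mono ?_
  rintro _ ⟨l, rfl⟩
  exact ⟨⟨i, l⟩, rfl⟩

/-- If `Ā` is ascending and satisfies property `PAb_d`, then
`B(η,δ) = max{n : δ ↣ n·e_1}` (under `2Ā(η,·)`-decomposition) satisfies property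
`PB_d`: every graded vector space of forms with dimension vector `δ` lies in a
`K`-subalgebra generated by an `R_η`-sequence of forms of degrees at most `d` and
length at most `B(η,δ)`. -/
theorem decomposition_bound_satisfies_PB {K : Type*} [Field K] [IsAlgClosed K]
    (d : ℕ) (hd : 2 ≤ d)
    (Abar : ℕ → (Fin d → ℕ) → ℕ) (hApos : ∀ η δ, 0 < Abar η δ)
    (hAasc : ∀ (η η' : ℕ) (δ δ' : Fin d → ℕ), η ≤ η' → (∀ j, δ j ≤ δ' j) →
      Abar η δ ≤ Abar η' δ')
    (hPAb : ∀ (η : ℕ), 1 ≤ η → ∀ (N : ℕ) (δ : Fin d → ℕ)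
      (V : Fin d → Submodule K (MvPolynomial (Fin N) K)),
      (∀ i : Fin d, ∀ f ∈ V i, f.IsHomogeneous ((i : ℕ) + 1)) →
      (∀ i : Fin d, Module.finrank K (V i) = δ i) →
      (∀ j : Fin d, ∀ G ∈ V j, G ≠ 0 → ¬ HasCollapse (Abar η δ) G) →
      ∀ (n : ℕ) (y : Fin n → MvPolynomial (Fin N) K),
        (∀ i : Fin n, ∃ j : Fin d, y i ∈ V j) → LinearIndependent K y →
        IsSerreSeq η y)
    (B : ℕ → (Fin d → ℕ) → ℕ)
    (hB : ∀ (η : ℕ) (δ : Fin d → ℕ), 1 ≤ η →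
      IsGreatest {n : ℕ | Dec (fun δ' => 2 * Abar η δ') δ (unitVec d n)} (B η δ)) :
    ∀ (η : ℕ), 1 ≤ η → ∀ (N : ℕ) (δ : Fin d → ℕ)
      (V : Fin d → Submodule K (MvPolynomial (Fin N) K)),
      (∀ i : Fin d, ∀ f ∈ V i, f.IsHomogeneous ((i : ℕ) + 1)) →
      (∀ i : Fin d, Module.finrank K (V i) = δ i) →
      ∃ n : ℕ, n ≤ B η δ ∧ ∃ y : Fin n → MvPolynomial (Fin N) K,
        (∀ j, ∃ e : ℕ, 0 < e ∧ e ≤ d ∧ (y j).IsHomogeneous e) ∧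
        IsSerreSeq η y ∧
        ∀ i : Fin d, (V i : Set (MvPolynomial (Fin N) K)) ⊆
          (Algebra.adjoin K (Set.range y) : Subalgebra K (MvPolynomial (Fin N) K)) := by
  intro η hη
  set F : (Fin d → ℕ) → ℕ := fun δ => 2 * Abar η δ
  have hFpos : ∀ δ, 0 < F δ := fun δ => Nat.mul_pos two_pos (hApos η δ)
  have hFmono : Monotone F := fun δ ε h => Nat.mul_le_mul_left 2 (hAasc η η δ ε le_rfl h)
  have hBdec : ∀ δ, Dec F δ (unitVec d (B η δ)) := fun δ => (hB η δ hη).1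
  have hBmax : ∀ δ n, Dec F δ (unitVec d n) → n ≤ B η δ := fun δ n h => (hB η δ hη).2 h
  let z : Fin d := ⟨0, by omega⟩
  have hsumunit : ∀ n, ∑ i, unitVec d n i = n := fun n => by
    rw [Finset.sum_eq_single z]
    · simp [unitVec, z]
    · intro i _ hi
      exact if_neg fun h => hi (Fin.ext h)
    · simp
  have hBsum : ∀ δ, ∑ i, δ i ≤ B η δ := fun δ =>
    (Dec.sum_le_sum hFpos (hBdec δ)).trans_eq (hsumunit _)
  have hBmono : ∀ δ ε, δ ≤ ε → B η δ ≤ B η ε := fun δ ε h => by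
    obtain ⟨ε', hdec, hle⟩ := (hBdec δ).exists_ge hFmono h
    have h1 := hle z
    have h2 := (hBdec ε').apply_zero_le z rfl
    have h3 := hBmax ε _ (hdec.trans (hBdec ε'))
    simp only [unitVec, z, if_true] at h1 h2
    exact (h1.trans h2).trans h3
  have hBstep : ∀ δ ε, SimpleDec F δ ε → B η ε ≤ B η δ := fun δ ε h =>
    hBmax δ _ ((Relation.ReflTransGen.single h).trans (hBdec ε))
  intro N δ
  have hwf : WellFounded (Pi.Lex (β := fun _ : Fin d => ℕ) (· > ·) fun {_} => (· < ·)) :=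
    Pi.Lex.wellFounded _ fun _ => wellFounded_lt
  induction δ using hwf.induction with
  | _ δ ih =>
  intro V hV hdim
  by_cases hstr : ∀ j : Fin d, ∀ G ∈ V j, G ≠ 0 → ¬ HasCollapse (Abar η δ) G
  · obtain ⟨y, hyV, hyli, hspan⟩ := exists_homogeneous_basis hV
    refine ⟨_, ?_, y, fun l => ?_, hPAb η hη N δ V hV hdim hstr _ y hyV hyli, fun i p hp => ?_⟩
    · simp only [hdim]
      exact hBsum δ
    · obtain ⟨j, hj⟩ := hyV l
      exact ⟨j + 1, by omega, by omega, hV j _ hj⟩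
    · exact Algebra.span_le_adjoin K _ (hspan i hp)
  · push Not at hstr
    obtain ⟨j, G, hG, hG0, hc⟩ := hstr
    obtain ⟨hj, V', hV', hlow, hat, hhigh, hgen⟩ := exists_reduction_of_hasCollapse hV hG hG0 hc
    simp only [hdim] at hlow hat
    obtain ⟨n, hn, y, hy, hyS, hyA⟩ := ih (fun i => Module.finrank K (V' i))
      ⟨j, fun i hi => by dsimp only; rw [hhigh i hi, hdim], hat⟩ V' hV' fun _ => rfl
    refine ⟨n, hn.trans (le_trans (hBmono _ _ fun i => ?_)
      (hBstep δ _ ⟨j, hj, by omega, rfl⟩)), y, hy, hyS, fun i p hp =>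
        hgen (Algebra.adjoin K (Set.range y)) (fun i q hq => hyA i hq) i hp⟩
    dsimp only
    rcases lt_trichotomy i j with h | rfl | h
    · rw [if_neg h.ne, if_pos (Fin.lt_def.1 h)]
      exact hlow i h
    · rw [if_pos rfl]
      omega
    · rw [if_neg h.ne', if_neg (by simpa using h.le), hhigh i h, hdim]
end
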